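/- arXiv:2603.26223 — 2 statements merged into one kernel-verified Lean document; each statement's English description precedes it below -/
import Mathlib

section
/- Let p ≡ 1 (mod 4) be prime and M = (p-1)/4. Then modulo p^5: Σ_{k=0}^{M} (8k+1) ((1/4)_k)^4/(k!)^4 ≡ ((1/2)_{(p-1)/4}/((p-1)/4)!) · (p - (p^3/16) H^{(2)}_{(p-1)/4}) + p^4 Σ_{k=1}^{(p-1)/4} (1)_{k-1}(1/2)_{k-1} / ((4k-3)^3 ((1/4)_{k-1})^2), where H^{(2)}_m = Σ_{j=1}^m 1/j^2. -/
open Finset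

/-- `A ≡ B (mod p^e)` for rational numbers, in the p-adic sense: the difference can be
written as `p^e · a / b` with `b` an integer not divisible by `p`. -/
def ratCongr (A B : ℚ) (p : ℕ) (e : ℕ) : Prop :=
  ∃ a b : ℤ, ¬ (p : ℤ) ∣ b ∧ (A - B) * (b : ℚ) = (p : ℚ) ^ e * (a : ℚ)

/-- The Pochhammer symbol (rising factorial) `(a)_k = a(a+1)⋯(a+k-1)` for rational `a`. -/
noncomputable def rpoch (a : ℚ) (k : ℕ) : ℚ := (ascPochhammer ℚ k).eval a

/-- The harmonic number of order 2: `H^{(2)}_m = Σ_{j=1}^m 1/j^2`. -/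
def H2 (m : ℕ) : ℚ := ∑ j ∈ Finset.Icc 1 m, 1 / (j : ℚ) ^ 2

theorem rpoch_zero (a : ℚ) : rpoch a 0 = 1 := by simp [rpoch]

theorem rpoch_succ (a : ℚ) (k : ℕ) : rpoch a (k + 1) = rpoch a k * (a + k) := by
  simp [rpoch, ascPochhammer_succ_eval]

theorem rpoch_pos {a : ℚ} (ha : 0 < a) (k : ℕ) : 0 < rpoch a k := by
  induction k with
  | zero => simp [rpoch_zero]
  | succ k ih => rw [rpoch_succ]; positivity

theorem rpoch_succ_left (a : ℚ) (k : ℕ) : a * rpoch (a + 1) k = rpoch a k * (a + k) := by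
  induction k with
  | zero => simp [rpoch_zero]
  | succ k ih =>
    rw [rpoch_succ, rpoch_succ, ← mul_assoc, ih]; push_cast; ring

theorem rpoch_neg_natCast_eq_zero {n k : ℕ} (h : n < k) : rpoch (-(n : ℚ)) k = 0 := by
  induction k with
  | zero => omega
  | succ k ih =>
    rw [rpoch_succ]
    rcases Nat.lt_succ_iff_lt_or_eq.mp h with h' | h'
    · rw [ih h', zero_mul]
    · subst h'; simp

theorem rpoch_natCast_add_one (l j : ℕ) :
    (l.factorial : ℚ) * rpoch ((l : ℚ) + 1) j = ((l + j).factorial : ℚ) := by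
  induction j with
  | zero => simp [rpoch_zero]
  | succ j ih =>
    rw [rpoch_succ, ← mul_assoc, ih, ← add_assoc, Nat.factorial_succ]; push_cast; ring

/-- The factor of the well-poised summand that does not involve the free parameter. -/
def wpNum (m r : ℚ) (k : ℕ) : ℚ :=
  ∏ i ∈ range k, ((r - m + i) * (m + 1 / 2 + r + i)) / ((5 / 4 + m + i) * (3 / 4 - m + i))

/-- The factor of the well-poised summand that involves the free parameter `Y`. -/
def wpPar (Y r : ℚ) (k : ℕ) : ℚ :=
  ∏ i ∈ range k, ((1 / 4 + i) ^ 2 - Y) / ((1 + r + i) ^ 2 - Y)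

theorem wpNum_succ (m r : ℚ) (k : ℕ) : wpNum m r (k + 1) = wpNum m r k *
    (((r - m + k) * (m + 1 / 2 + r + k)) / ((5 / 4 + m + k) * (3 / 4 - m + k))) :=
  prod_range_succ _ k

theorem wpPar_succ (Y r : ℚ) (k : ℕ) : wpPar Y r (k + 1) = wpPar Y r k *
    (((1 / 4 + k) ^ 2 - Y) / ((1 + r + k) ^ 2 - Y)) :=
  prod_range_succ _ k

theorem wpNum_shift (m r : ℚ) (k : ℕ) :
    wpNum m r k * ((r - m + k) * (m + 1 / 2 + r + k)) =
      (r - m) * (m + 1 / 2 + r) * wpNum m (r + 1) k := by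
  induction k with
  | zero => simp [wpNum]
  | succ k ih =>
    rw [wpNum_succ, wpNum_succ, ← mul_assoc ((r - m) * (m + 1 / 2 + r)), ← ih]
    push_cast; ring

theorem wpPar_shift (Y r : ℚ) (k : ℕ) :
    wpPar Y r k / ((1 + r + k) ^ 2 - Y) = wpPar Y (r + 1) k / ((1 + r) ^ 2 - Y) := by
  induction k with
  | zero => simp [wpPar]
  | succ k ih =>
    rw [wpPar_succ, wpPar_succ]
    have : wpPar Y (r + 1) k * (((1 / 4 + k) ^ 2 - Y) / ((1 + (r + 1) + k) ^ 2 - Y)) /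
      ((1 + r) ^ 2 - Y) = (wpPar Y (r + 1) k / ((1 + r) ^ 2 - Y)) *
        (((1 / 4 + k) ^ 2 - Y) / ((1 + (r + 1) + k) ^ 2 - Y)) := by ring
    rw [this, ← ih]; push_cast; ring

theorem wpNum_eq_zero {M r k : ℕ} (hr : r ≤ M) (hk : M - r < k) :
    wpNum (M : ℚ) r k = 0 := by
  refine prod_eq_zero (mem_range.mpr hk) ?_
  have : (r : ℚ) - M + ((M - r : ℕ) : ℚ) = 0 := by push_cast [hr]; ring
  rw [this]; simp

theorem three_quarters_sub_ne_zero (M i : ℕ) : (3 / 4 - (M : ℚ) + i) ≠ 0 := by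
  intro h
  have h2 : (3 + 4 * (i : ℚ)) = 4 * M := by linarith
  have h3 : 3 + 4 * i = 4 * M := by exact_mod_cast h2
  omega

theorem wp_sum_step {M r : ℕ} (hr : r ≤ M) {Y : ℚ}
    (hY : ∀ i : ℕ, (1 + (i : ℚ)) ^ 2 - Y ≠ 0) :
    (1 / 4 + (r : ℚ)) * ∑ k ∈ range (M + 1),
        (2 * (k : ℚ) + 1 / 4 + r) * wpNum M r k * wpPar Y r k =
      (M + 1 / 4 : ℚ) ^ 2 + (3 / 4 + r) * ((r - M) * (M + 1 / 2 + r)) / ((1 + (r : ℚ)) ^ 2 - Y) *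
        ∑ k ∈ range (M + 1),
          (2 * (k : ℚ) + 1 / 4 + (r + 1)) * wpNum M (r + 1) k * wpPar Y (r + 1) k := by
  have hY' : ∀ i : ℕ, (1 + (r : ℚ) + i) ^ 2 - Y ≠ 0 := by
    intro i
    have := hY (r + i)
    push_cast at this
    rwa [add_assoc]
  have key : ∀ n : ℕ, ∑ k ∈ range n,
      ((1 / 4 + (r : ℚ)) * ((2 * (k : ℚ) + 1 / 4 + r) * wpNum M r k * wpPar Y r k) -
        (3 / 4 + r) * ((r - M) * (M + 1 / 2 + r)) / ((1 + (r : ℚ)) ^ 2 - Y) *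
        ((2 * (k : ℚ) + 1 / 4 + (r + 1)) * wpNum M (r + 1) k * wpPar Y (r + 1) k)) =
      wpNum M r n * ((M + n + 1 / 4) * (n - 1 / 4 - M)) * wpPar Y r n + (M + 1 / 4 : ℚ) ^ 2 := by
    intro n
    induction n with
    | zero => simp [wpNum, wpPar]; ring
    | succ n ih =>
      rw [sum_range_succ, ih]
      have s1 := wpNum_shift M r n
      have s2 := wpPar_shift Y r n
      have h1 : (3 / 4 + (r : ℚ)) * ((r - M) * (M + 1 / 2 + r)) / ((1 + (r : ℚ)) ^ 2 - Y) *
        ((2 * (n : ℚ) + 1 / 4 + (r + 1)) * wpNum M (r + 1) n * wpPar Y (r + 1) n) =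
        (3 / 4 + r) * (2 * n + 1 / 4 + (r + 1)) *
          (wpNum M r n * ((r - M + n) * (M + 1 / 2 + r + n))) *
          (wpPar Y r n / ((1 + r + n) ^ 2 - Y)) := by
        rw [s1, s2]; ring
      rw [h1, wpNum_succ, wpPar_succ]
      have n1 := hY' n
      have n2 := three_quarters_sub_ne_zero M n
      have n3 : (5 / 4 + (M : ℚ) + n) ≠ 0 := by positivity
      have n4 : wpNum (M : ℚ) r n * (((r - M + n) * (M + 1 / 2 + r + n)) /
          ((5 / 4 + M + n) * (3 / 4 - M + n))) *
          ((M + (n + 1 : ℕ) + 1 / 4) * ((n + 1 : ℕ) - 1 / 4 - M)) =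
          wpNum (M : ℚ) r n * ((r - M + n) * (M + 1 / 2 + r + n)) := by
        have : ((M : ℚ) + (n + 1 : ℕ) + 1 / 4) * ((n + 1 : ℕ) - 1 / 4 - M) =
          (5 / 4 + M + n) * (3 / 4 - M + n) := by push_cast; ring
        rw [this, mul_assoc, div_mul_cancel₀ _ (mul_ne_zero n3 n2)]
      rw [n4]
      field_simp
      ring
  have h := key (M + 1)
  rw [wpNum_eq_zero hr (by omega), sum_sub_distrib, ← mul_sum, ← mul_sum] at h
  linarith

/-- The summand of the balanced series to which the well-poised one transforms. -/
noncomputable def balTerm (m Y : ℚ) (j : ℕ) : ℚ :=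
  rpoch (3 / 4) j * rpoch (m + 1 / 2) j * rpoch (-m) j / rpoch (5 / 4) j /
    ∏ i ∈ range j, ((1 + (i : ℚ)) ^ 2 - Y)

theorem wp_sum_eq_bal_sum (M : ℕ) {Y : ℚ} (hY : ∀ i : ℕ, (1 + (i : ℚ)) ^ 2 - Y ≠ 0) :
    ∑ k ∈ range (M + 1), (8 * (k : ℚ) + 1) * wpNum M 0 k * wpPar Y 0 k =
      (4 * M + 1 : ℚ) ^ 2 * ∑ j ∈ range (M + 1), balTerm M Y j := by
  have key : ∀ r : ℕ, r ≤ M + 1 →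
      ∑ k ∈ range (M + 1), (8 * (k : ℚ) + 1) * wpNum M 0 k * wpPar Y 0 k =
      (4 * M + 1 : ℚ) ^ 2 * ∑ j ∈ range r, balTerm M Y j +
      4 * (4 * r + 1) * balTerm M Y r * ∑ k ∈ range (M + 1),
        (2 * (k : ℚ) + 1 / 4 + r) * wpNum M r k * wpPar Y r k := by
    intro r
    induction r with
    | zero =>
      intro _
      simp only [range_zero, sum_empty, mul_zero, zero_add, balTerm, rpoch_zero, prod_empty,
        mul_sum]
      refine sum_congr rfl fun k _ => ?_
      push_cast; ring
    | succ r ih =>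
      intro hr
      rw [ih (by omega), sum_range_succ (balTerm (M : ℚ) Y)]
      have st := wp_sum_step (show r ≤ M by omega) hY
      push_cast
      set S := ∑ k ∈ range (M + 1), (2 * (k : ℚ) + 1 / 4 + r) * wpNum M r k * wpPar Y r k
      set S' := ∑ k ∈ range (M + 1),
        (2 * (k : ℚ) + 1 / 4 + (r + 1)) * wpNum M (r + 1) k * wpPar Y (r + 1) k
      have h1 : 4 * (4 * (r : ℚ) + 1) * balTerm M Y r * S =
          16 * balTerm M Y r * ((1 / 4 + (r : ℚ)) * S) := by ring
      rw [h1, st]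
      have n1 := hY r
      have n2 : rpoch (5 / 4) r ≠ 0 := (rpoch_pos (by norm_num) r).ne'
      have n3 : (5 / 4 + (r : ℚ)) ≠ 0 := by positivity
      have e : 4 * (4 * ((r : ℚ) + 1) + 1) * balTerm M Y (r + 1) =
          16 * balTerm M Y r *
            ((3 / 4 + r) * ((r - M) * (M + 1 / 2 + r)) / ((1 + (r : ℚ)) ^ 2 - Y)) := by
        simp only [balTerm, rpoch_succ, prod_range_succ]
        have n5 : ∏ i ∈ range r, ((1 + (i : ℚ)) ^ 2 - Y) ≠ 0 :=
          prod_ne_zero_iff.mpr fun i _ => hY i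
        field_simp
        ring
      rw [e]; ring
  have h := key (M + 1) le_rfl
  have hz : balTerm M Y (M + 1) = 0 := by
    simp [balTerm, rpoch_neg_natCast_eq_zero (Nat.lt_succ_self M)]
  rw [h, hz]; ring

/-- The summand of the balanced series evaluated by the Pfaff–Saalschütz theorem. -/
noncomputable def saalTerm (n : ℕ) (l : ℚ) (j : ℕ) : ℚ :=
  rpoch (-(n : ℚ)) j * rpoch (3 / 4) j * rpoch (n + l + 1 / 2) j /
    (j.factorial * rpoch (5 / 4) j * rpoch (l + 1) j)

theorem saal_sum {l : ℚ} (hl : 0 ≤ l) (n : ℕ) : ∀ N : ℕ, n < N →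
    ∑ j ∈ range N, saalTerm n l j =
      rpoch (1 / 2) n * rpoch (l + 1 / 4) n / (rpoch (5 / 4) n * rpoch (l + 1) n) := by
  induction n with
  | zero =>
    intro N hN
    rw [sum_eq_single_of_mem 0 (mem_range.mpr hN)]
    · simp [saalTerm, rpoch_zero]
    · intro j _ hj
      rw [saalTerm, rpoch_neg_natCast_eq_zero (Nat.pos_of_ne_zero hj)]; simp
  | succ n ih =>
    intro N hN
    let τ : ℕ → ℚ := fun j => rpoch (-((n + 1 : ℕ) : ℚ)) j * rpoch (3 / 4) j *
      rpoch (n + l + 1 / 2) j / (j.factorial * rpoch (5 / 4) j * rpoch (l + 1) j)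
    have hp1 : ∀ j, rpoch (5 / 4) j ≠ 0 := fun j => (rpoch_pos (by norm_num) j).ne'
    have hp2 : ∀ j, rpoch (l + 1) j ≠ 0 := fun j => (rpoch_pos (by positivity) j).ne'
    have hf : ∀ j : ℕ, (j.factorial : ℚ) ≠ 0 := fun j => by positivity
    have hB : (n + l + 1 / 2 : ℚ) ≠ 0 := by positivity
    have hn1 : (n + 1 : ℚ) ≠ 0 := by positivity
    have t0 : ∀ j, saalTerm n l j * (n + 1) = τ j * (n + 1 - j) := by
      intro j
      have := rpoch_succ_left (-((n + 1 : ℕ) : ℚ)) j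
      have e : -((n + 1 : ℕ) : ℚ) + 1 = -(n : ℚ) := by push_cast; ring
      rw [e] at this
      have h2 : rpoch (-(n : ℚ)) j * (n + 1) = rpoch (-((n + 1 : ℕ) : ℚ)) j * (n + 1 - j) := by
        push_cast at this ⊢; linarith
      simp only [saalTerm, τ]
      rw [div_mul_eq_mul_div, div_mul_eq_mul_div]
      congr 1
      linear_combination rpoch (3 / 4) j * rpoch (n + l + 1 / 2) j * h2
    have t1 : ∀ j, saalTerm (n + 1) l j * (n + l + 1 / 2) = τ j * (n + l + 1 / 2 + j) := by
      intro j
      have := rpoch_succ_left (n + l + 1 / 2 : ℚ) j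
      have e : (n + l + 1 / 2 : ℚ) + 1 = ((n + 1 : ℕ) : ℚ) + l + 1 / 2 := by push_cast; ring
      rw [e] at this
      simp only [saalTerm, τ]
      rw [div_mul_eq_mul_div, div_mul_eq_mul_div]
      congr 1
      linear_combination rpoch (3 / 4) j * rpoch (-((n + 1 : ℕ) : ℚ)) j * this
    have ts : ∀ j, τ (j + 1) * ((j + 1) * (5 / 4 + j) * (l + 1 + j)) =
        τ j * ((j - n - 1) * (3 / 4 + j) * (n + l + 1 / 2 + j)) := by
      intro j
      have a1 := hp1 j
      have a2 := hp2 j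
      have a3 := hf j
      have a4 : (5 / 4 + j : ℚ) ≠ 0 := by positivity
      have a5 : (l + 1 + j : ℚ) ≠ 0 := by positivity
      have a6 : (j + 1 : ℚ) ≠ 0 := by positivity
      simp only [τ, rpoch_succ, Nat.factorial_succ]
      push_cast
      field_simp
      ring
    have tel : ∀ K : ℕ, ∑ j ∈ range K,
        ((n + 5 / 4) * (n + l + 1) * saalTerm (n + 1) l j -
          (n + 1 / 2) * (n + l + 1 / 4) * saalTerm n l j) =
        -(2 * n + l + 3 / 2) * (K * (K + 1 / 4) * (l + K)) * τ K /
          ((n + 1) * (n + l + 1 / 2)) := by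
      intro K
      induction K with
      | zero => simp
      | succ K ihK =>
        rw [sum_range_succ, ihK]
        have b0 : saalTerm n l K = τ K * (n + 1 - K) / (n + 1) := by
          rw [eq_div_iff hn1]; exact t0 K
        have b1 : saalTerm (n + 1) l K = τ K * (n + l + 1 / 2 + K) / (n + l + 1 / 2) := by
          rw [eq_div_iff hB]; exact t1 K
        have b2 := ts K
        rw [b0, b1]
        rw [eq_div_iff (by positivity)]
        have b3 : -(2 * (n : ℚ) + l + 3 / 2) *
            (((K + 1 : ℕ) : ℚ) * ((K + 1 : ℕ) + 1 / 4) * (l + (K + 1 : ℕ))) * τ (K + 1) =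
            -(2 * (n : ℚ) + l + 3 / 2) *
            (τ K * ((K - n - 1) * (3 / 4 + K) * (n + l + 1 / 2 + K))) := by
          rw [← b2]; push_cast; ring
        rw [b3]
        field_simp
        ring
    have hτ : τ N = 0 := by simp only [τ]; rw [rpoch_neg_natCast_eq_zero hN]; simp
    have h := tel N
    rw [hτ, sum_sub_distrib, ← mul_sum, ← mul_sum, ih N (by omega)] at h
    have c1 := hp1 n
    have c2 := hp2 n
    have c3 : (5 / 4 + n : ℚ) ≠ 0 := by positivity
    have c4 : (l + 1 + n : ℚ) ≠ 0 := by positivity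
    have c5 : (n + 5 / 4 : ℚ) * (n + l + 1) ≠ 0 := by positivity
    apply mul_left_cancel₀ c5
    rw [mul_zero, zero_div, sub_eq_zero] at h
    rw [h, rpoch_succ, rpoch_succ, rpoch_succ, rpoch_succ]
    field_simp
    ring

/-- The coefficients expanding `∏ ((j + 1 + i)² - Y)` in the Newton basis at `0, 1, 4, 9, …`. -/
def newtonCoeff (n j l : ℕ) : ℚ :=
  n.choose l * ((j + n).factorial * (j + n - l).factorial) / (j.factorial * (j + l).factorial)

theorem newtonCoeff_succ_zero (n j : ℕ) :
    newtonCoeff (n + 1) j 0 = ((j : ℚ) + 1) ^ 2 * newtonCoeff n (j + 1) 0 := by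
  have h : j + 1 + n = j + (n + 1) := by omega
  simp only [newtonCoeff, Nat.choose_zero_right, Nat.sub_zero, add_zero, h, Nat.factorial_succ j]
  have : (j.factorial : ℚ) ≠ 0 := by positivity
  have : (j + 1 : ℚ) ≠ 0 := by positivity
  push_cast
  field_simp

theorem newtonCoeff_succ_succ (n j l : ℕ) (hl : l ≤ n) :
    newtonCoeff (n + 1) j (l + 1) = newtonCoeff n (j + 1) l +
      (((j : ℚ) + 1) ^ 2 - (l + 1) ^ 2) * newtonCoeff n (j + 1) (l + 1) := by
  obtain ⟨d, rfl⟩ := Nat.exists_eq_add_of_le hl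
  have h1 : j + (l + d + 1) - (l + 1) = j + d := by omega
  have h2 : j + (l + d + 1) - l = j + d + 1 := by omega
  have h4 : j + 1 + (l + d) = j + (l + d + 1) := by omega
  have h5 : j + 1 + l = j + (l + 1) := by omega
  have h6 : j + 1 + (l + 1) = j + (l + 1) + 1 := by omega
  have hc : ((l + d).choose (l + 1) : ℚ) * (l + 1) = (l + d).choose l * d := by
    have := Nat.choose_succ_right_eq (l + d) l
    rw [Nat.add_sub_cancel_left] at this
    exact_mod_cast this
  have hc' : ((l + d).choose (l + 1) : ℚ) = (l + d).choose l * d / (l + 1) := by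
    rw [eq_div_iff (by positivity)]; exact hc
  simp only [newtonCoeff, h1, h2, h4, h5, h6, Nat.choose_succ_succ, Nat.factorial_succ j,
    Nat.factorial_succ (j + d), Nat.factorial_succ (j + (l + 1))]
  push_cast
  rw [hc']
  have : (j.factorial : ℚ) ≠ 0 := by positivity
  have : ((j + (l + 1)).factorial : ℚ) ≠ 0 := by positivity
  have : (j + 1 : ℚ) ≠ 0 := by positivity
  have : (j + (l + 1) + 1 : ℚ) ≠ 0 := by positivity
  field_simp
  ring

theorem prod_eq_sum_newton (Y : ℚ) (n : ℕ) : ∀ j : ℕ,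
    ∏ i ∈ range n, (((j : ℚ) + 1 + i) ^ 2 - Y) =
      ∑ l ∈ range (n + 1), newtonCoeff n j l * ∏ i ∈ range l, ((i : ℚ) ^ 2 - Y) := by
  induction n with
  | zero =>
    intro j
    have : (j.factorial : ℚ) ≠ 0 := by positivity
    simp [newtonCoeff]
    field_simp
  | succ n ih =>
    intro j
    have h0 : ∏ i ∈ range (n + 1), (((j : ℚ) + 1 + i) ^ 2 - Y) =
        (((j : ℚ) + 1) ^ 2 - Y) * ∏ i ∈ range n, ((((j + 1 : ℕ) : ℚ) + 1 + i) ^ 2 - Y) := by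
      rw [prod_range_succ', mul_comm]
      congr 1
      · simp
      · refine prod_congr rfl fun i _ => ?_
        push_cast; ring
    rw [h0, ih (j + 1), mul_sum]
    have h1 : ∀ l ∈ range (n + 1), (((j : ℚ) + 1) ^ 2 - Y) *
        (newtonCoeff n (j + 1) l * ∏ i ∈ range l, ((i : ℚ) ^ 2 - Y)) =
        newtonCoeff n (j + 1) l * ∏ i ∈ range (l + 1), ((i : ℚ) ^ 2 - Y) +
        (((j : ℚ) + 1) ^ 2 - l ^ 2) * newtonCoeff n (j + 1) l *
          ∏ i ∈ range l, ((i : ℚ) ^ 2 - Y) := by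
      intro l _
      rw [prod_range_succ]; ring
    rw [sum_congr rfl h1, sum_add_distrib, sum_range_succ' _ (n + 1)]
    have h2 : ∑ l ∈ range (n + 1), (((j : ℚ) + 1) ^ 2 - l ^ 2) * newtonCoeff n (j + 1) l *
          ∏ i ∈ range l, ((i : ℚ) ^ 2 - Y) =
        ∑ l ∈ range (n + 1), (((j : ℚ) + 1) ^ 2 - (l + 1) ^ 2) * newtonCoeff n (j + 1) (l + 1) *
          ∏ i ∈ range (l + 1), ((i : ℚ) ^ 2 - Y) + ((j : ℚ) + 1) ^ 2 * newtonCoeff n (j + 1) 0 := by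
      have z : newtonCoeff n (j + 1) (n + 1) = 0 := by simp [newtonCoeff]
      have e := sum_range_succ (fun l : ℕ => (((j : ℚ) + 1) ^ 2 - (l : ℚ) ^ 2) *
        newtonCoeff n (j + 1) l * ∏ i ∈ range l, ((i : ℚ) ^ 2 - Y)) (n + 1)
      rw [z] at e
      rw [sum_range_succ'] at e
      simp only [mul_zero, zero_mul, add_zero] at e
      rw [← e]
      simp
    rw [h2, newtonCoeff_succ_zero, ← add_assoc, ← sum_add_distrib]
    simp only [range_zero, prod_empty, mul_one]
    congr 1
    refine sum_congr rfl fun l hl => ?_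
    rw [newtonCoeff_succ_succ n j l (by have := mem_range.mp hl; omega)]
    ring

theorem rpoch_neg_mul_choose {M l : ℕ} (hl : l ≤ M) (j : ℕ) (hj : j ≤ M) :
    rpoch (-(M : ℚ)) j * (M - j).choose l * ((M - l).factorial * l.factorial) =
      M.factorial * rpoch (-((M - l : ℕ) : ℚ)) j := by
  induction j with
  | zero =>
    simp only [rpoch_zero, Nat.sub_zero, one_mul, mul_one]
    rw [mul_comm ((M - l).factorial : ℚ), ← mul_assoc]
    exact_mod_cast Nat.choose_mul_factorial_mul_factorial hl
  | succ j ih =>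
    have ih := ih (by omega)
    obtain ⟨d, rfl⟩ := Nat.exists_eq_add_of_le hj
    have e1 : j + 1 + d - j = d + 1 := by omega
    have e2 : j + 1 + d - (j + 1) = d := by omega
    rw [e1] at ih
    rw [e2, rpoch_succ, rpoch_succ]
    have hc : (d.choose l : ℚ) * (d + 1) = (d + 1).choose l * (d + 1 - l) := by
      rcases le_or_gt l (d + 1) with h | h
      · have := Nat.choose_mul_succ_eq d l
        have h' : ((d.choose l * (d + 1) : ℕ) : ℚ) = ((d + 1).choose l * (d + 1 - l) : ℕ) := by
          rw [this]
        push_cast [h] at h'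
        exact h'
      · rw [Nat.choose_eq_zero_of_lt h, Nat.choose_eq_zero_of_lt (by omega)]; simp
    rw [← mul_assoc ((j + 1 + d).factorial : ℚ), ← ih]
    push_cast [hl]
    linear_combination -(rpoch (-(j + 1 + d)) j) *
      (((j + 1 + d - l).factorial : ℚ) * l.factorial) * hc

theorem rpoch_add (a : ℚ) (m n : ℕ) : rpoch a (m + n) = rpoch a m * rpoch (a + m) n := by
  induction n with
  | zero => simp [rpoch_zero]
  | succ n ih => rw [← add_assoc, rpoch_succ, rpoch_succ, ih]; push_cast; ring

theorem prod_sq_sub_split (Y : ℚ) {M j : ℕ} (hj : j ≤ M) :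
    ∏ i ∈ range M, ((1 + (i : ℚ)) ^ 2 - Y) =
      (∏ i ∈ range j, ((1 + (i : ℚ)) ^ 2 - Y)) *
        ∏ i ∈ range (M - j), (((j : ℚ) + 1 + i) ^ 2 - Y) := by
  obtain ⟨d, rfl⟩ := Nat.exists_eq_add_of_le hj
  rw [prod_range_add, Nat.add_sub_cancel_left]
  congr 1
  refine prod_congr rfl fun i _ => ?_
  push_cast; ring

/-- The `k`-th well-poised summand, cleared of denominators in the free parameter `Y`. -/
def wpPoly (M : ℕ) (Y : ℚ) (k : ℕ) : ℚ :=
  (∏ i ∈ range k, ((1 / 4 + (i : ℚ)) ^ 2 - Y)) *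
    ∏ i ∈ range (M - k), (((k : ℚ) + 1 + i) ^ 2 - Y)

theorem wpPoly_eq_wpPar {M k : ℕ} (hk : k ≤ M) {Y : ℚ}
    (hY : ∀ i : ℕ, (1 + (i : ℚ)) ^ 2 - Y ≠ 0) :
    wpPoly M Y k = (∏ i ∈ range M, ((1 + (i : ℚ)) ^ 2 - Y)) * wpPar Y 0 k := by
  have h : ∏ i ∈ range k, ((1 + (i : ℚ)) ^ 2 - Y) ≠ 0 := prod_ne_zero_iff.mpr fun i _ => hY i
  rw [prod_sq_sub_split Y hk, wpPar, prod_div_distrib, wpPoly]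
  simp only [add_zero]
  field_simp

theorem one_add_sq_sub_ne_zero (M i : ℕ) : (1 + (i : ℚ)) ^ 2 - (M + 1 / 4) ^ 2 ≠ 0 := by
  have h := mul_ne_zero (show (5 / 4 + (M : ℚ) + i) ≠ 0 by positivity)
    (three_quarters_sub_ne_zero M i)
  intro h0
  exact h (by linear_combination h0)

theorem wpPoly_eq_wpNum {M k : ℕ} (hk : k ≤ M) :
    wpPoly M ((M + 1 / 4 : ℚ) ^ 2) k =
      (∏ i ∈ range M, ((1 + (i : ℚ)) ^ 2 - (M + 1 / 4) ^ 2)) * wpNum M 0 k := by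
  rw [wpPoly_eq_wpPar hk (one_add_sq_sub_ne_zero M)]
  congr 1
  refine prod_congr rfl fun i _ => ?_
  congr 1 <;> ring

/-- The coefficients of the Newton expansion of the well-poised bilinear sum. -/
noncomputable def wpCoeff (M l : ℕ) : ℚ :=
  (4 * M + 1 : ℚ) ^ 2 * (M.factorial / l.factorial) *
    (rpoch (1 / 2) (M - l) * rpoch (1 / 4) M / (rpoch (1 / 4) l * rpoch (5 / 4) (M - l)))

theorem sum_mul_newtonCoeff {M l : ℕ} (hl : l ≤ M) :
    (4 * M + 1 : ℚ) ^ 2 * ∑ j ∈ range (M + 1),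
      rpoch (3 / 4) j * rpoch (M + 1 / 2) j * rpoch (-(M : ℚ)) j / rpoch (5 / 4) j *
        newtonCoeff (M - j) j l = wpCoeff M l := by
  have hp1 : ∀ j, rpoch (5 / 4) j ≠ 0 := fun j => (rpoch_pos (by norm_num) j).ne'
  have hf : ∀ j : ℕ, (j.factorial : ℚ) ≠ 0 := fun j => by positivity
  have hterm : ∀ j ∈ range (M + 1),
      rpoch (3 / 4) j * rpoch (M + 1 / 2) j * rpoch (-(M : ℚ)) j / rpoch (5 / 4) j *
        newtonCoeff (M - j) j l =
      ((M.factorial : ℚ) / l.factorial) ^ 2 * saalTerm (M - l) l j := by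
    intro j hj
    have hj : j ≤ M := Nat.lt_succ_iff.mp (mem_range.mp hj)
    have h1 := rpoch_neg_mul_choose hl j hj
    have h2 := rpoch_natCast_add_one l j
    have h3 : ((M - l : ℕ) : ℚ) + l + 1 / 2 = M + 1 / 2 := by push_cast [hl]; ring
    have h4 : j + (M - j) = M := by omega
    have hpl : rpoch ((l : ℚ) + 1) j ≠ 0 := (rpoch_pos (by positivity) j).ne'
    have := hp1 j
    have := hf j
    have := hf l
    have := hf (M - l)
    rw [newtonCoeff, saalTerm, h3, h4, add_comm j l, ← h2]
    have h5 : rpoch (-((M - l : ℕ) : ℚ)) j = rpoch (-(M : ℚ)) j * (M - j).choose l *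
        ((M - l).factorial * l.factorial) / M.factorial := by
      rw [eq_div_iff (hf M), h1]; ring
    have := hf M
    rw [h5]
    field_simp
  rw [sum_congr rfl hterm, ← mul_sum, saal_sum (by positivity) _ _ (by omega), wpCoeff]
  have h1 := rpoch_natCast_add_one l (M - l)
  have h2 := rpoch_add (1 / 4) l (M - l)
  rw [show l + (M - l) = M by omega] at h1 h2
  rw [h2, add_comm (l : ℚ) (1 / 4), ← h1]
  have := hp1 (M - l)
  have := hf l
  have : rpoch ((l : ℚ) + 1) (M - l) ≠ 0 := (rpoch_pos (by positivity) _).ne'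
  have : rpoch (1 / 4) l ≠ 0 := (rpoch_pos (by norm_num) l).ne'
  field_simp

theorem sum_wpPoly_mul_wpPoly (M : ℕ) {Y : ℚ} (hY : ∀ i : ℕ, (1 + (i : ℚ)) ^ 2 - Y ≠ 0) :
    ∑ k ∈ range (M + 1), (8 * (k : ℚ) + 1) * (wpPoly M ((M + 1 / 4 : ℚ) ^ 2) k * wpPoly M Y k) =
      (∏ i ∈ range M, ((1 + (i : ℚ)) ^ 2 - (M + 1 / 4) ^ 2)) *
        ∑ l ∈ range (M + 1), wpCoeff M l * ∏ i ∈ range l, ((i : ℚ) ^ 2 - Y) := by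
  set D := ∏ i ∈ range M, ((1 + (i : ℚ)) ^ 2 - (M + 1 / 4) ^ 2)
  set E := ∏ i ∈ range M, ((1 + (i : ℚ)) ^ 2 - Y) with hE
  have h1 : ∑ k ∈ range (M + 1),
      (8 * (k : ℚ) + 1) * (wpPoly M ((M + 1 / 4 : ℚ) ^ 2) k * wpPoly M Y k) =
      D * E * ∑ k ∈ range (M + 1), (8 * (k : ℚ) + 1) * wpNum M 0 k * wpPar Y 0 k := by
    rw [mul_sum]
    refine sum_congr rfl fun k hk => ?_
    have hk : k ≤ M := Nat.lt_succ_iff.mp (mem_range.mp hk)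
    rw [wpPoly_eq_wpNum hk, wpPoly_eq_wpPar hk hY]
    ring
  have h2 : ∀ j ∈ range (M + 1), E * balTerm M Y j = ∑ l ∈ range (M + 1),
      rpoch (3 / 4) j * rpoch (M + 1 / 2) j * rpoch (-(M : ℚ)) j / rpoch (5 / 4) j *
        newtonCoeff (M - j) j l * ∏ i ∈ range l, ((i : ℚ) ^ 2 - Y) := by
    intro j hj
    have hj : j ≤ M := Nat.lt_succ_iff.mp (mem_range.mp hj)
    have h : ∏ i ∈ range j, ((1 + (i : ℚ)) ^ 2 - Y) ≠ 0 := prod_ne_zero_iff.mpr fun i _ => hY i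
    have h3 : ∑ l ∈ range (M + 1), newtonCoeff (M - j) j l * ∏ i ∈ range l, ((i : ℚ) ^ 2 - Y) =
        ∏ i ∈ range (M - j), (((j : ℚ) + 1 + i) ^ 2 - Y) := by
      rw [prod_eq_sum_newton]
      symm
      refine sum_subset (range_subset_range.mpr (by omega)) fun l _ hl => ?_
      have : (M - j).choose l = 0 := Nat.choose_eq_zero_of_lt (by simp at hl; omega)
      simp [newtonCoeff, this]
    simp only [mul_assoc (_ / _ : ℚ)]
    rw [← mul_sum, h3, hE, prod_sq_sub_split Y hj, balTerm]
    field_simp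
  rw [h1, wp_sum_eq_bal_sum M hY]
  calc D * E * ((4 * M + 1 : ℚ) ^ 2 * ∑ j ∈ range (M + 1), balTerm M Y j)
      = D * ((4 * M + 1 : ℚ) ^ 2 * ∑ j ∈ range (M + 1), E * balTerm M Y j) := by
        rw [← mul_sum]; ring
    _ = _ := by
        rw [sum_congr rfl h2, sum_comm, mul_sum]
        congr 1
        refine sum_congr rfl fun l hl => ?_
        rw [← sum_mul_newtonCoeff (Nat.lt_succ_iff.mp (mem_range.mp hl)), ← sum_mul]
        ring

section DividedDifference

open Polynomial

/-- An integral rescaling of `wpPoly` as a polynomial in the free parameter. -/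
noncomputable def wpPolynomial (R : Type*) [CommRing R] (M k : ℕ) : R[X] :=
  (∏ i ∈ range k, (C ((4 * (i : R) + 1) ^ 2) - X)) *
    ∏ i ∈ range (M - k), (C ((4 * ((k : R) + 1 + i)) ^ 2) - X)

theorem cast_eval_wpPolynomial {M k : ℕ} (hk : k ≤ M) (y : ℤ) :
    (((wpPolynomial ℤ M k).eval y : ℤ) : ℚ) = 16 ^ M * wpPoly M ((y : ℚ) / 16) k := by
  have h : (16 : ℚ) ^ M = (∏ _i ∈ range k, 16) * ∏ _i ∈ range (M - k), 16 := by
    rw [prod_const, prod_const, card_range, card_range, ← pow_add, Nat.add_sub_cancel' hk]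
  rw [wpPolynomial, wpPoly, eval_mul, eval_prod, eval_prod, h, mul_mul_mul_comm,
    ← prod_mul_distrib, ← prod_mul_distrib]
  push_cast
  congr 1
  · refine prod_congr rfl fun i _ => ?_
    simp only [eval_sub, eval_C, eval_X]; push_cast; ring
  · refine prod_congr rfl fun i _ => ?_
    simp only [eval_sub, eval_C, eval_X]; push_cast; ring

theorem map_wpPolynomial (R : Type*) [CommRing R] (M k : ℕ) :
    (wpPolynomial ℤ M k).map (Int.castRingHom R) = wpPolynomial R M k := by
  have h : (C (4 : R)) = 4 := map_ofNat C 4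
  simp [wpPolynomial, Polynomial.map_prod, h]

theorem wpPolynomial_symm {R : Type*} [CommRing R] {M k : ℕ} (hM : (4 * (M : R) + 1) = 0)
    (hk : k ≤ M) : wpPolynomial R M (M - k) = wpPolynomial R M k := by
  have key : ∀ n ≤ M, ∏ i ∈ range n, (C ((4 * (i : R) + 1) ^ 2) - X) =
      ∏ i ∈ range n, (C ((4 * (((M - n : ℕ) : R) + 1 + i)) ^ 2) - X) := by
    intro n hn
    rw [← prod_range_reflect]
    refine prod_congr rfl fun i hi => ?_
    have hi := mem_range.mp hi
    have h1 : ((n - 1 - i : ℕ) : R) = n - 1 - i := by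
      rw [Nat.cast_sub (by omega), Nat.cast_sub (by omega)]; simp
    congr 2
    rw [h1, Nat.cast_sub hn]
    linear_combination (4 * (n : R) - 4 - 4 * i + 1 - (4 * (M - n + 1 + i))) * hM
  have h2 := key k hk
  have h3 := key (M - k) (by omega)
  rw [Nat.sub_sub_self hk] at h3
  rw [wpPolynomial, wpPolynomial, Nat.sub_sub_self hk, h2, h3, mul_comm]

theorem exists_sum_sq_sub_eq {p M : ℕ} (hp : p.Prime) (hM : p = 4 * M + 1) :
    ∃ z : ℤ, ∑ k ∈ range (M + 1), (8 * (k : ℤ) + 1) *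
      ((wpPolynomial ℤ M k).eval 0 - (wpPolynomial ℤ M k).eval ((p : ℤ) ^ 2)) ^ 2 =
      (p : ℤ) ^ 5 * z := by
  have : Fact p.Prime := ⟨hp⟩
  have hM0 : (4 * (M : ZMod p) + 1) = 0 := by
    have : ((4 * M + 1 : ℕ) : ZMod p) = 0 := by rw [← hM]; simp
    exact_mod_cast this
  let e : ℕ → ℤ := fun k => (divX (wpPolynomial ℤ M k)).eval ((p : ℤ) ^ 2)
  have he : ∀ k, (wpPolynomial ℤ M k).eval 0 - (wpPolynomial ℤ M k).eval ((p : ℤ) ^ 2) =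
      -(e k * (p : ℤ) ^ 2) := by
    intro k
    have h1 := congrArg (eval ((p : ℤ) ^ 2)) (divX_mul_X_add (wpPolynomial ℤ M k))
    simp only [eval_add, eval_mul, eval_X, eval_C] at h1
    rw [← h1, ← coeff_zero_eq_eval_zero]
    ring
  have hc : ∀ k, ((e k : ℤ) : ZMod p) = (wpPolynomial (ZMod p) M k).coeff 1 := by
    intro k
    have h1 : ((e k : ℤ) : ZMod p) =
        ((divX (wpPolynomial ℤ M k)).map (Int.castRingHom (ZMod p))).eval
          (((p : ℤ) ^ 2 : ℤ) : ZMod p) := by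
      simp only [e, eval_intCast_map]; simp
    have h2 : (((p : ℤ) ^ 2 : ℤ) : ZMod p) = 0 := by simp
    rw [h1, h2, ← coeff_zero_eq_eval_zero, coeff_map, coeff_divX,
      ← map_wpPolynomial (ZMod p), coeff_map]
  have hS : ((∑ k ∈ range (M + 1), (8 * (k : ℤ) + 1) * e k ^ 2 : ℤ) : ZMod p) = 0 := by
    push_cast
    have h1 := sum_range_reflect (fun k : ℕ => (8 * (k : ZMod p) + 1) * (e k : ZMod p) ^ 2) (M + 1)
    have h2 : ∑ k ∈ range (M + 1), (8 * ((M + 1 - 1 - k : ℕ) : ZMod p) + 1) *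
        (e (M + 1 - 1 - k) : ZMod p) ^ 2 =
        - ∑ k ∈ range (M + 1), (8 * (k : ZMod p) + 1) * (e k : ZMod p) ^ 2 := by
      rw [← sum_neg_distrib]
      refine sum_congr rfl fun k hk => ?_
      have hk : k ≤ M := Nat.lt_succ_iff.mp (mem_range.mp hk)
      rw [hc, hc, Nat.add_sub_cancel, wpPolynomial_symm hM0 hk, Nat.cast_sub hk]
      linear_combination 2 * (wpPolynomial (ZMod p) M k).coeff 1 ^ 2 * hM0
    rw [h2] at h1
    have h3 : (2 : ZMod p) ≠ 0 := by
      intro h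
      have : p ∣ 2 := (ZMod.natCast_eq_zero_iff 2 p).mp (by exact_mod_cast h)
      have := (Nat.prime_dvd_prime_iff_eq hp Nat.prime_two).mp this
      omega
    refine (mul_eq_zero.mp (?_ : (2 : ZMod p) * _ = 0)).resolve_left h3
    linear_combination -h1
  obtain ⟨z, hz⟩ := (ZMod.intCast_zmod_eq_zero_iff_dvd _ p).mp hS
  refine ⟨z, ?_⟩
  simp only [he]
  calc ∑ k ∈ range (M + 1), (8 * (k : ℤ) + 1) * (-(e k * (p : ℤ) ^ 2)) ^ 2
      = (p : ℤ) ^ 4 * ∑ k ∈ range (M + 1), (8 * (k : ℤ) + 1) * e k ^ 2 := by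
        rw [mul_sum]
        refine sum_congr rfl fun k _ => ?_
        ring
    _ = _ := by rw [hz]; ring

end DividedDifference

section Integrality

variable (p : ℕ) [hp : Fact p.Prime]

/-- The subring of `ℚ` of rationals with denominator prime to `p`. -/
def pIntegral : Subring ℚ where
  carrier := {x | ∃ a b : ℤ, ¬ (p : ℤ) ∣ b ∧ x * b = a}
  mul_mem' := by
    rintro x y ⟨a, b, hb, h⟩ ⟨c, d, hd, h'⟩
    refine ⟨a * c, b * d, fun hbd => ?_, by push_cast; rw [← h, ← h']; ring⟩
    exact ((Nat.prime_iff_prime_int.mp hp.out).dvd_or_dvd hbd).elim hb hd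
  one_mem' := ⟨1, 1, fun h => (Nat.prime_iff_prime_int.mp hp.out).not_isUnit
    (isUnit_of_dvd_one h), by simp⟩
  add_mem' := by
    rintro x y ⟨a, b, hb, h⟩ ⟨c, d, hd, h'⟩
    refine ⟨a * d + c * b, b * d, fun hbd => ?_, by push_cast; rw [← h, ← h']; ring⟩
    exact ((Nat.prime_iff_prime_int.mp hp.out).dvd_or_dvd hbd).elim hb hd
  zero_mem' := ⟨0, 1, fun h => (Nat.prime_iff_prime_int.mp hp.out).not_isUnit
    (isUnit_of_dvd_one h), by simp⟩
  neg_mem' := by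
    rintro x ⟨a, b, hb, h⟩
    exact ⟨-a, b, hb, by push_cast; rw [← h]; ring⟩

variable {p}

theorem ratCongr_of_eq_add {A B c : ℚ} {e : ℕ} (hc : c ∈ pIntegral p)
    (h : A = B + (p : ℚ) ^ e * c) : ratCongr A B p e := by
  obtain ⟨a, b, hb, hab⟩ := hc
  exact ⟨a, b, hb, by rw [h, ← hab]; ring⟩

theorem inv_natCast_mem_pIntegral {n : ℕ} (hn : ¬ p ∣ n) : ((n : ℚ))⁻¹ ∈ pIntegral p := by
  refine ⟨1, n, by exact_mod_cast hn, ?_⟩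
  have : (n : ℚ) ≠ 0 := by
    rintro h
    exact hn (by rw [Nat.cast_eq_zero.mp h]; exact dvd_zero p)
  push_cast; exact inv_mul_cancel₀ this

theorem inv_factorial_mem_pIntegral {n : ℕ} (hn : n < p) :
    ((n.factorial : ℚ))⁻¹ ∈ pIntegral p :=
  inv_natCast_mem_pIntegral fun h => absurd (hp.out.dvd_factorial.mp h) (by omega)

theorem rpoch_mem_pIntegral {a : ℚ} (ha : a ∈ pIntegral p) (k : ℕ) :
    rpoch a k ∈ pIntegral p := by
  induction k with
  | zero => rw [rpoch_zero]; exact one_mem _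
  | succ k ih => rw [rpoch_succ]; exact mul_mem ih (add_mem ha (natCast_mem _ k))

theorem exists_prod_one_sub_eq {n : ℕ} {x : ℚ} {a : ℕ → ℚ} (hx : x ∈ pIntegral p)
    (ha : ∀ i < n, a i ∈ pIntegral p) :
    ∃ c ∈ pIntegral p, ∏ i ∈ range n, (1 - x * a i) = 1 - x * ∑ i ∈ range n, a i + x ^ 2 * c := by
  induction n with
  | zero => exact ⟨0, zero_mem _, by simp⟩
  | succ n ih =>
    obtain ⟨c, hc, h⟩ := ih fun i hi => ha i (by omega)
    have h1 : ∑ i ∈ range n, a i ∈ pIntegral p :=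
      sum_mem fun i hi => ha i (by have := mem_range.mp hi; omega)
    have h2 := ha n (by omega)
    refine ⟨c + a n * ∑ i ∈ range n, a i - x * a n * c, ?_, ?_⟩
    · exact sub_mem (add_mem hc (mul_mem h2 h1)) (mul_mem (mul_mem hx h2) hc)
    · rw [prod_range_succ, sum_range_succ, h]; ring

theorem exists_sum_eq_add {ι : Type*} {s : Finset ι} {f g : ι → ℚ} {e : ℕ}
    (h : ∀ i ∈ s, ∃ c ∈ pIntegral p, f i = g i + (p : ℚ) ^ e * c) :
    ∃ c ∈ pIntegral p, ∑ i ∈ s, f i = ∑ i ∈ s, g i + (p : ℚ) ^ e * c := by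
  choose! c hc hfg using h
  exact ⟨∑ i ∈ s, c i, sum_mem hc, by rw [mul_sum, ← sum_add_distrib, sum_congr rfl hfg]⟩

variable {M : ℕ} (hM : p = 4 * M + 1)

include hM

theorem one_div_four_mem_pIntegral : (1 / 4 : ℚ) ∈ pIntegral p := by
  have : ((4 : ℕ) : ℚ)⁻¹ ∈ pIntegral p := by
    apply inv_natCast_mem_pIntegral
    intro h
    have h4 : p ∣ 2 * 2 := h
    have h5 := (hp.out.dvd_mul.mp h4)
    have := Nat.le_of_dvd two_pos (h5.elim id id)
    have := hp.out.two_le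
    omega
  simpa using this

theorem one_div_two_mem_pIntegral : (1 / 2 : ℚ) ∈ pIntegral p := by
  have := add_mem (one_div_four_mem_pIntegral hM) (one_div_four_mem_pIntegral hM)
  norm_num at this
  simpa using this

theorem inv_four_mul_add_one_mem_pIntegral {i : ℕ} (hi : i < M) :
    (4 * (i : ℚ) + 1)⁻¹ ∈ pIntegral p := by
  have : ((4 * i + 1 : ℕ) : ℚ)⁻¹ ∈ pIntegral p :=
    inv_natCast_mem_pIntegral (Nat.not_dvd_of_pos_of_lt (by omega) (by omega))
  push_cast at this
  exact this

theorem inv_rpoch_mem_pIntegral {k : ℕ} (hk : k ≤ M) :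
    (rpoch (1 / 4) k)⁻¹ ∈ pIntegral p := by
  induction k with
  | zero => rw [rpoch_zero, inv_one]; exact one_mem _
  | succ k ih =>
    have h : (1 / 4 + (k : ℚ))⁻¹ = 4 * (4 * (k : ℚ) + 1)⁻¹ := by
      have : (4 * (k : ℚ) + 1) ≠ 0 := by positivity
      field_simp; ring
    rw [rpoch_succ, mul_inv, h]
    exact mul_mem (ih (by omega))
      (mul_mem (ofNat_mem _ 4) (inv_four_mul_add_one_mem_pIntegral hM (by omega)))

theorem exists_rpoch_mul_factorial_eq {k : ℕ} (hk : k ≤ M) :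
    ∃ c ∈ pIntegral p, rpoch (1 / 4) k * ((M - k).factorial : ℚ) =
      (-1) ^ k * M.factorial + p * c := by
  induction k with
  | zero => exact ⟨0, zero_mem _, by simp [rpoch_zero]⟩
  | succ k ih =>
    obtain ⟨c, hc, h⟩ := ih (by omega)
    obtain ⟨d, rfl⟩ := Nat.exists_eq_add_of_le hk
    rw [show k + 1 + d - k = d + 1 by omega, Nat.factorial_succ] at h
    rw [show k + 1 + d - (k + 1) = d by omega]
    have h4 := one_div_four_mem_pIntegral hM
    refine ⟨rpoch (1 / 4) k * d.factorial * (1 / 4) - c, ?_, ?_⟩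
    · exact sub_mem (mul_mem (mul_mem (rpoch_mem_pIntegral h4 k) (natCast_mem _ _)) h4) hc
    · rw [rpoch_succ, pow_succ]
      have hpq : (p : ℚ) = 4 * (k + 1 + d) + 1 := by rw [hM]; push_cast; ring
      push_cast at h
      rw [hpq] at h ⊢
      linear_combination -h

theorem exists_prod_sq_sub_eq {n : ℕ} (hn : n ≤ M) :
    ∃ c ∈ pIntegral p, ∏ i ∈ range n, ((1 + (i : ℚ)) ^ 2 - (M + 1 / 4) ^ 2) =
      (n.factorial : ℚ) ^ 2 *
        (1 - (p : ℚ) ^ 2 / 16 * ∑ i ∈ range n, 1 / (1 + (i : ℚ)) ^ 2 + (p : ℚ) ^ 4 * c) := by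
  have h4 := one_div_four_mem_pIntegral hM
  have ha : ∀ i < n, (1 / 4) ^ 2 * (((i + 1 : ℕ) : ℚ)⁻¹) ^ 2 ∈ pIntegral p := fun i hi =>
    mul_mem (pow_mem h4 2) (pow_mem (inv_natCast_mem_pIntegral
      (Nat.not_dvd_of_pos_of_lt (by omega) (by omega))) 2)
  obtain ⟨c, hc, h⟩ := exists_prod_one_sub_eq (pow_mem (natCast_mem (pIntegral p) p) 2) ha
  refine ⟨c, hc, ?_⟩
  have hf : (n.factorial : ℚ) ^ 2 = ∏ i ∈ range n, (1 + (i : ℚ)) ^ 2 := by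
    rw [prod_pow, ← prod_range_add_one_eq_factorial]; push_cast
    simp only [add_comm]
  have hs : (p : ℚ) ^ 2 / 16 * ∑ i ∈ range n, 1 / (1 + (i : ℚ)) ^ 2 =
      (p : ℚ) ^ 2 * ∑ i ∈ range n, (1 / 4) ^ 2 * (((i + 1 : ℕ) : ℚ)⁻¹) ^ 2 := by
    rw [mul_sum, mul_sum]
    refine sum_congr rfl fun i _ => ?_
    have : (1 + (i : ℚ)) ≠ 0 := by positivity
    push_cast
    rw [add_comm (i : ℚ) 1]
    field_simp
    norm_num
  rw [hs, show (p : ℚ) ^ 4 = ((p : ℚ) ^ 2) ^ 2 by ring, ← h, hf, ← prod_mul_distrib]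
  refine prod_congr rfl fun i _ => ?_
  have : (1 + (i : ℚ)) ≠ 0 := by positivity
  have hpq : (p : ℚ) = 4 * M + 1 := by rw [hM]; push_cast; ring
  rw [hpq]
  push_cast
  rw [add_comm (i : ℚ) 1]
  field_simp

omit hp in
theorem wpCoeff_eq (i : ℕ) (hi : i ≤ M) :
    wpCoeff M (M - i) = (p : ℚ) ^ 2 * (M.factorial / (M - i).factorial) *
      (rpoch (1 / 2) i * rpoch (1 / 4) M /
        (rpoch (1 / 4) (M - i) * ((4 * i + 1) * rpoch (1 / 4) i))) := by
  have h := rpoch_succ_left (1 / 4) i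
  norm_num at h
  rw [wpCoeff, Nat.sub_sub_self hi, hM]
  have h' : rpoch (5 / 4) i = (4 * i + 1) * rpoch (1 / 4) i := by linarith
  rw [h']
  push_cast; rfl

theorem exists_unit_ratio_eq {l i : ℕ} (hli : l + 1 + i = M) :
    ∃ c ∈ pIntegral p,
      rpoch (1 / 2) i * rpoch (1 / 4) M * (l.factorial : ℚ) ^ 2 /
        (16 * M.factorial * (l + 1).factorial * rpoch (1 / 4) (l + 1) *
          ((4 * i + 1) * rpoch (1 / 4) i)) =
      i.factorial * rpoch (1 / 2) i / ((4 * (i : ℚ) + 1) ^ 3 * rpoch (1 / 4) i ^ 2) + p * c := by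
  obtain ⟨a, ha, h1⟩ := exists_rpoch_mul_factorial_eq hM (le_refl M)
  obtain ⟨b, hb, h2⟩ := exists_rpoch_mul_factorial_eq hM (show i ≤ M by omega)
  obtain ⟨c, hc, h3⟩ := exists_rpoch_mul_factorial_eq hM (show l + 1 ≤ M by omega)
  have h4 := one_div_four_mem_pIntegral hM
  rw [Nat.sub_self, Nat.factorial_zero, Nat.cast_one, mul_one] at h1
  rw [show M - i = l + 1 by omega] at h2
  rw [show M - (l + 1) = i by omega] at h3
  have hi4 : (4 * (i : ℚ) + 1) = p - 4 * (l + 1) := by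
    rw [hM, ← hli]; push_cast; ring
  have hfl : ((l + 1).factorial : ℚ) = (l + 1) * l.factorial := by
    rw [Nat.factorial_succ]; push_cast; ring
  have hsgn : ((-1 : ℚ)) ^ M * (-1) ^ i = (-1) ^ (l + 1) := by
    rw [← pow_add, ← hli, show l + 1 + i + i = (l + 1) + 2 * i by ring, pow_add _ (l + 1), pow_mul]
    simp
  have hN : ∀ n : ℕ, (n : ℚ) ∈ pIntegral p := fun n => natCast_mem _ n
  have hq : ∀ k, rpoch (1 / 4) k ∈ pIntegral p := rpoch_mem_pIntegral h4
  have hε : ∀ k, (-1 : ℚ) ^ k ∈ pIntegral p := fun k => pow_mem (neg_mem (one_mem _)) k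
  have hO : ∀ n : ℕ, [n.AtLeastTwo] → (ofNat(n) : ℚ) ∈ pIntegral p := fun n _ => ofNat_mem _ n
  set qM := rpoch (1 / 4) M
  set qi := rpoch (1 / 4) i
  set ql := rpoch (1 / 4) (l + 1)
  set mf : ℚ := (M.factorial : ℚ)
  set lf : ℚ := (l.factorial : ℚ)
  set sf : ℚ := ((l + 1).factorial : ℚ)
  set jf : ℚ := (i.factorial : ℚ)
  set εM := (-1 : ℚ) ^ M
  set εi := (-1 : ℚ) ^ i
  set εl := (-1 : ℚ) ^ (l + 1)
  have hbr : qM * lf ^ 2 * (4 * (i : ℚ) + 1) ^ 2 * qi - 16 * mf * sf * ql * jf =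
      p * (qM * lf ^ 2 * qi * (p - 8 * (l + 1)) +
        16 * sf * (εM * mf * b + εi * mf * a + p * a * b - mf * c)) := by
    have e1 : qM * (qi * sf) - mf * (ql * jf) =
        p * (εM * mf * b + εi * mf * a + p * a * b - mf * c) := by
      rw [h1, h2, h3]
      linear_combination mf ^ 2 * hsgn
    rw [hi4]
    have e2 : 16 * sf * (qM * (qi * sf)) = 16 * qM * qi * (l + 1) ^ 2 * lf ^ 2 := by
      rw [hfl]; ring
    linear_combination 16 * sf * e1 - e2
  refine ⟨(qM * lf ^ 2 * qi * (p - 8 * (l + 1)) +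
        16 * sf * (εM * mf * b + εi * mf * a + p * a * b - mf * c)) *
        (rpoch (1 / 2) i * (1 / 4) ^ 2 * mf⁻¹ * sf⁻¹ * ql⁻¹ * (4 * (i : ℚ) + 1)⁻¹ ^ 3 * qi⁻¹ ^ 2),
      ?_, ?_⟩
  · refine mul_mem ?_ ?_
    · refine add_mem (mul_mem (mul_mem (mul_mem (hq _) (pow_mem (hN _) 2)) (hq _)) ?_)
        (mul_mem (mul_mem (hO 16) (hN _)) ?_)
      · exact sub_mem (hN _) (mul_mem (hO 8) (add_mem (hN _) (one_mem _)))
      · exact sub_mem (add_mem (add_mem (mul_mem (mul_mem (hε _) (hN _)) hb)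
          (mul_mem (mul_mem (hε _) (hN _)) ha)) (mul_mem (mul_mem (hN _) ha) hb))
          (mul_mem (hN _) hc)
    · exact mul_mem (mul_mem (mul_mem (mul_mem (mul_mem (mul_mem
        (rpoch_mem_pIntegral (one_div_two_mem_pIntegral hM) i)
        (pow_mem h4 2)) (inv_factorial_mem_pIntegral (by omega)))
        (inv_factorial_mem_pIntegral (by omega))) (inv_rpoch_mem_pIntegral hM (by omega)))
        (pow_mem (inv_four_mul_add_one_mem_pIntegral hM (by omega)) 3))
        (pow_mem (inv_rpoch_mem_pIntegral hM (by omega)) 2)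
  · rw [← mul_assoc (p : ℚ), ← hbr]
    have : (4 * (i : ℚ) + 1) ≠ 0 := by positivity
    have : qi ≠ 0 := (rpoch_pos (by norm_num) _).ne'
    have : ql ≠ 0 := (rpoch_pos (by norm_num) _).ne'
    have : mf ≠ 0 := by positivity
    have : sf ≠ 0 := by positivity
    field_simp
    ring

end Integrality

theorem sum_Icc_one_eq_sum_range (f : ℕ → ℚ) (n : ℕ) :
    ∑ k ∈ Icc 1 n, f k = ∑ i ∈ range n, f (i + 1) := by
  induction n with
  | zero => simp
  | succ n ih => rw [sum_Icc_succ_top (by omega), ih, sum_range_succ]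

theorem rpoch_eq_prod (a : ℚ) (k : ℕ) : rpoch a k = ∏ i ∈ range k, (a + i) := by
  induction k with
  | zero => simp [rpoch_zero]
  | succ k ih => rw [rpoch_succ, prod_range_succ, ih]

theorem rpoch_one (k : ℕ) : rpoch 1 k = k.factorial := by
  have := rpoch_natCast_add_one 0 k
  simpa using this

theorem wpPoly_zero {M k : ℕ} (hk : k ≤ M) :
    wpPoly M 0 k = (rpoch (1 / 4) k * (M.factorial / k.factorial)) ^ 2 := by
  have h := rpoch_natCast_add_one k (M - k)
  rw [show k + (M - k) = M by omega] at h
  have : (k.factorial : ℚ) ≠ 0 := by positivity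
  rw [wpPoly, ← h, mul_div_cancel_left₀ _ this, mul_pow, rpoch_eq_prod, rpoch_eq_prod]
  simp only [sub_zero, prod_pow]

theorem sum_eq_kernel_add {p M : ℕ} [hp : Fact p.Prime] (hM : p = 4 * M + 1) :
    ∃ c ∈ pIntegral p,
      ∑ k ∈ range (M + 1), (8 * (k : ℚ) + 1) * (rpoch (1 / 4) k) ^ 4 / ((k.factorial : ℚ)) ^ 4 =
      (∏ i ∈ range M, ((1 + (i : ℚ)) ^ 2 - (M + 1 / 4) ^ 2)) / (M.factorial : ℚ) ^ 4 *
        (wpCoeff M 0 - ∑ l ∈ range M, wpCoeff M (l + 1) *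
          ∏ i ∈ range (l + 1), ((i : ℚ) ^ 2 - (M + 1 / 4) ^ 2)) + (p : ℚ) ^ 5 * c := by
  obtain ⟨z, hz⟩ := exists_sum_sq_sub_eq hp.out hM
  have hP : ((((p : ℤ) ^ 2 : ℤ) : ℚ)) / 16 = (M + 1 / 4) ^ 2 := by
    rw [hM]; push_cast; ring
  have h0 := sum_wpPoly_mul_wpPoly M (Y := 0) fun i => by
    rw [sub_zero]; positivity
  have hPP := sum_wpPoly_mul_wpPoly M (one_add_sq_sub_ne_zero M)
  set D := ∏ i ∈ range M, ((1 + (i : ℚ)) ^ 2 - (M + 1 / 4) ^ 2)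
  rw [sum_range_succ' (fun l => wpCoeff M l * _)] at h0 hPP
  have hvan : ∀ l : ℕ, ∏ i ∈ range (l + 1), ((i : ℚ) ^ 2 - 0) = 0 := fun l =>
    prod_eq_zero (mem_range.mpr l.succ_pos) (by simp)
  simp only [hvan, mul_zero, sum_const_zero, range_zero, prod_empty, mul_one, zero_add] at h0
  rw [range_zero, prod_empty, mul_one] at hPP
  have hz' : (16 ^ M : ℚ) ^ 2 * ∑ k ∈ range (M + 1), (8 * (k : ℚ) + 1) *
      (wpPoly M 0 k - wpPoly M ((M + 1 / 4 : ℚ) ^ 2) k) ^ 2 = (p : ℚ) ^ 5 * z := by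
    have := congrArg (Int.cast (R := ℚ)) hz
    push_cast at this
    rw [← this, mul_sum]
    refine sum_congr rfl fun k hk => ?_
    have hk : k ≤ M := Nat.lt_succ_iff.mp (mem_range.mp hk)
    rw [cast_eval_wpPolynomial hk, cast_eval_wpPolynomial hk, hP]
    simp only [Int.cast_zero, zero_div]
    ring
  have hL : (M.factorial : ℚ) ^ 4 * ∑ k ∈ range (M + 1),
      (8 * (k : ℚ) + 1) * (rpoch (1 / 4) k) ^ 4 / ((k.factorial : ℚ)) ^ 4 =
      ∑ k ∈ range (M + 1), (8 * (k : ℚ) + 1) * wpPoly M 0 k ^ 2 := by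
    rw [mul_sum]
    refine sum_congr rfl fun k hk => ?_
    rw [wpPoly_zero (Nat.lt_succ_iff.mp (mem_range.mp hk))]
    ring
  have hexp : ∑ k ∈ range (M + 1), (8 * (k : ℚ) + 1) *
      (wpPoly M 0 k - wpPoly M ((M + 1 / 4 : ℚ) ^ 2) k) ^ 2 =
      ∑ k ∈ range (M + 1), (8 * (k : ℚ) + 1) * wpPoly M 0 k ^ 2 - 2 *
      ∑ k ∈ range (M + 1), (8 * (k : ℚ) + 1) *
        (wpPoly M ((M + 1 / 4 : ℚ) ^ 2) k * wpPoly M 0 k) +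
      ∑ k ∈ range (M + 1), (8 * (k : ℚ) + 1) *
        (wpPoly M ((M + 1 / 4 : ℚ) ^ 2) k * wpPoly M ((M + 1 / 4 : ℚ) ^ 2) k) := by
    rw [mul_sum, ← sum_sub_distrib, ← sum_add_distrib]
    refine sum_congr rfl fun k _ => ?_
    ring
  rw [hexp, ← hL, h0, hPP] at hz'
  have hf : (M.factorial : ℚ) ≠ 0 := by positivity
  have h4 := one_div_four_mem_pIntegral hM
  refine ⟨z * (((1 / 4) ^ 2) ^ M) ^ 2 * (M.factorial : ℚ)⁻¹ ^ 4, ?_, ?_⟩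
  · exact mul_mem (mul_mem (intCast_mem _ z) (pow_mem (pow_mem (pow_mem h4 2) M) 2))
      (pow_mem (inv_factorial_mem_pIntegral (by omega)) 4)
  · have h16 : (16 ^ M : ℚ) * ((1 / 4) ^ 2) ^ M = 1 := by
      rw [← mul_pow]; norm_num
    have hff : (M.factorial : ℚ) * (M.factorial : ℚ)⁻¹ = 1 := mul_inv_cancel₀ hf
    set w : ℚ := ((1 / 4) ^ 2) ^ M
    set s : ℚ := 16 ^ M
    rw [show (p : ℚ) ^ 5 * (z * w ^ 2 * (M.factorial : ℚ)⁻¹ ^ 4) =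
      (p : ℚ) ^ 5 * z * (w ^ 2 * (M.factorial : ℚ)⁻¹ ^ 4) by ring, ← hz',
      show ∀ x : ℚ, s ^ 2 * x * (w ^ 2 * (M.factorial : ℚ)⁻¹ ^ 4) =
        (s * w) ^ 2 * (x / (M.factorial : ℚ) ^ 4) by intro x; field_simp, h16]
    field_simp
    ring

theorem exists_prod_sq_sub_eq_mul {p M n : ℕ} [hp : Fact p.Prime] (hM : p = 4 * M + 1)
    (hn : n ≤ M) :
    ∃ c ∈ pIntegral p, ∏ i ∈ range n, ((1 + (i : ℚ)) ^ 2 - (M + 1 / 4) ^ 2) =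
      (n.factorial : ℚ) ^ 2 * (1 + p * c) := by
  obtain ⟨c, hc, h⟩ := exists_prod_sq_sub_eq hM hn
  have hp0 := natCast_mem (pIntegral p) p
  have hs : ∑ i ∈ range n, 1 / (1 + (i : ℚ)) ^ 2 ∈ pIntegral p := by
    refine sum_mem fun i hi => ?_
    have hi := mem_range.mp hi
    have := inv_natCast_mem_pIntegral (p := p) (n := 1 + i)
      (Nat.not_dvd_of_pos_of_lt (by omega) (by omega))
    push_cast at this
    rw [one_div, ← inv_pow]
    exact pow_mem this 2
  refine ⟨(p : ℚ) ^ 3 * c - p * (1 / 4) ^ 2 * ∑ i ∈ range n, 1 / (1 + (i : ℚ)) ^ 2, ?_, ?_⟩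
  · exact sub_mem (mul_mem (pow_mem hp0 3) hc)
      (mul_mem (mul_mem hp0 (pow_mem (one_div_four_mem_pIntegral hM) 2)) hs)
  · rw [h]; ring

theorem exists_leading_eq {p M : ℕ} [hp : Fact p.Prime] (hM : p = 4 * M + 1) :
    ∃ c ∈ pIntegral p,
      (∏ i ∈ range M, ((1 + (i : ℚ)) ^ 2 - (M + 1 / 4) ^ 2)) / (M.factorial : ℚ) ^ 4 *
        wpCoeff M 0 =
      rpoch (1 / 2) M / M.factorial * ((p : ℚ) - (p : ℚ) ^ 3 / 16 * H2 M) + (p : ℚ) ^ 5 * c := by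
  obtain ⟨c, hc, h⟩ := exists_prod_sq_sub_eq hM (le_refl M)
  have hw := wpCoeff_eq hM M le_rfl
  have hH : H2 M = ∑ i ∈ range M, 1 / (1 + (i : ℚ)) ^ 2 := by
    rw [H2, sum_Icc_one_eq_sum_range (fun j : ℕ => 1 / (j : ℚ) ^ 2)]
    refine sum_congr rfl fun i _ => ?_
    push_cast; rw [add_comm]
  have hf : (M.factorial : ℚ) ≠ 0 := by positivity
  have hq : rpoch (1 / 4) M ≠ 0 := (rpoch_pos (by norm_num) _).ne'
  have hpq : 4 * (M : ℚ) + 1 = p := by rw [hM]; push_cast; ring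
  have hp0 : (p : ℚ) ≠ 0 := by exact_mod_cast hp.out.ne_zero
  rw [Nat.sub_self, Nat.factorial_zero, rpoch_zero, hpq] at hw
  refine ⟨rpoch (1 / 2) M * (M.factorial : ℚ)⁻¹ * c, ?_, ?_⟩
  · exact mul_mem (mul_mem (rpoch_mem_pIntegral (one_div_two_mem_pIntegral hM) M)
      (inv_factorial_mem_pIntegral (by omega))) hc
  · rw [h, hw, hH]
    field_simp
    ring

theorem exists_correction_eq {p M l i : ℕ} [hp : Fact p.Prime] (hM : p = 4 * M + 1)
    (hli : l + 1 + i = M) :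
    ∃ c ∈ pIntegral p,
      -((∏ j ∈ range M, ((1 + (j : ℚ)) ^ 2 - (M + 1 / 4) ^ 2)) / (M.factorial : ℚ) ^ 4 *
        (wpCoeff M (l + 1) * ∏ j ∈ range (l + 1), ((j : ℚ) ^ 2 - (M + 1 / 4) ^ 2))) =
      (p : ℚ) ^ 4 *
        (i.factorial * rpoch (1 / 2) i / ((4 * (i : ℚ) + 1) ^ 3 * rpoch (1 / 4) i ^ 2)) +
      (p : ℚ) ^ 5 * c := by
  obtain ⟨a, ha, h1⟩ := exists_prod_sq_sub_eq_mul hM (le_refl M)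
  obtain ⟨b, hb, h2⟩ := exists_prod_sq_sub_eq_mul hM (show l ≤ M by omega)
  obtain ⟨c, hc, h3⟩ := exists_unit_ratio_eq hM hli
  have hw := wpCoeff_eq hM i (by omega)
  rw [show M - i = l + 1 by omega] at hw
  have hprod : ∏ j ∈ range (l + 1), ((j : ℚ) ^ 2 - (M + 1 / 4) ^ 2) =
      (l.factorial : ℚ) ^ 2 * (1 + p * b) * (-((p : ℚ) ^ 2 / 16)) := by
    rw [prod_range_succ', ← h2]
    congr 1
    · refine prod_congr rfl fun j _ => ?_
      push_cast; ring
    · rw [hM]; push_cast; ring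
  have hp0 := natCast_mem (pIntegral p) p
  have ht : i.factorial * rpoch (1 / 2) i / ((4 * (i : ℚ) + 1) ^ 3 * rpoch (1 / 4) i ^ 2) ∈
      pIntegral p := by
    rw [div_eq_mul_inv, mul_inv, ← inv_pow, ← inv_pow]
    exact mul_mem (mul_mem (natCast_mem _ _)
      (rpoch_mem_pIntegral (one_div_two_mem_pIntegral hM) i))
      (mul_mem (pow_mem (inv_four_mul_add_one_mem_pIntegral hM (by omega)) 3)
        (pow_mem (inv_rpoch_mem_pIntegral hM (by omega)) 2))
  set t := i.factorial * rpoch (1 / 2) i / ((4 * (i : ℚ) + 1) ^ 3 * rpoch (1 / 4) i ^ 2)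
  refine ⟨c + (a + b + p * a * b) * (t + p * c), ?_, ?_⟩
  · exact add_mem hc (mul_mem (add_mem (add_mem ha hb) (mul_mem (mul_mem hp0 ha) hb))
      (add_mem ht (mul_mem hp0 hc)))
  · rw [h1, hw, hprod]
    have hf : (M.factorial : ℚ) ≠ 0 := by positivity
    have hi : (4 * (i : ℚ) + 1) ≠ 0 := by positivity
    have hqi : rpoch (1 / 4) i ≠ 0 := (rpoch_pos (by norm_num) _).ne'
    have hql : rpoch (1 / 4) (l + 1) ≠ 0 := (rpoch_pos (by norm_num) _).ne'
    have hl : ((l + 1).factorial : ℚ) ≠ 0 := by positivity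
    calc _ = (p : ℚ) ^ 4 * (1 + p * a) * (1 + p * b) *
        (rpoch (1 / 2) i * rpoch (1 / 4) M * (l.factorial : ℚ) ^ 2 /
        (16 * M.factorial * (l + 1).factorial * rpoch (1 / 4) (l + 1) *
          ((4 * i + 1) * rpoch (1 / 4) i))) := by field_simp
      _ = _ := by rw [h3]; ring

/-- Corollary 1.3, case `M = (p-1)/4`: for primes `p ≡ 1 (mod 4)`, modulo `p^5`. -/
theorem stmt12 (p : ℕ) (hp : p.Prime) (hp1 : p % 4 = 1) :
    ratCongr
      (∑ k ∈ Finset.range ((p - 1) / 4 + 1),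
        (8 * (k : ℚ) + 1) * (rpoch (1 / 4) k) ^ 4 / ((k.factorial : ℚ)) ^ 4)
      (rpoch (1 / 2) ((p - 1) / 4) / ((((p - 1) / 4).factorial : ℚ)) *
        ((p : ℚ) - (p : ℚ) ^ 3 / 16 * H2 ((p - 1) / 4)) +
       (p : ℚ) ^ 4 *
        ∑ k ∈ Finset.Icc 1 ((p - 1) / 4),
          rpoch 1 (k - 1) * rpoch (1 / 2) (k - 1) /
            ((4 * (k : ℚ) - 3) ^ 3 * (rpoch (1 / 4) (k - 1)) ^ 2))
      p 5 := by
  have : Fact p.Prime := ⟨hp⟩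
  obtain ⟨M, hM⟩ : ∃ M, p = 4 * M + 1 := ⟨p / 4, by omega⟩
  rw [show (p - 1) / 4 = M by omega]
  obtain ⟨a, ha, h1⟩ := sum_eq_kernel_add hM
  obtain ⟨b, hb, h2⟩ := exists_leading_eq hM
  obtain ⟨c, hc, h3⟩ := exists_sum_eq_add (s := range M) fun i hi =>
    exists_correction_eq hM (l := M - 1 - i) (i := i) (by have := mem_range.mp hi; omega)
  rw [← mul_sum, sum_neg_distrib, ← mul_sum, sum_range_reflect (fun l => wpCoeff M (l + 1) *
    ∏ j ∈ range (l + 1), ((j : ℚ) ^ 2 - (M + 1 / 4) ^ 2))] at h3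
  have h4 : ∑ k ∈ Icc 1 M, rpoch 1 (k - 1) * rpoch (1 / 2) (k - 1) /
      ((4 * (k : ℚ) - 3) ^ 3 * (rpoch (1 / 4) (k - 1)) ^ 2) =
      ∑ i ∈ range M, i.factorial * rpoch (1 / 2) i /
        ((4 * (i : ℚ) + 1) ^ 3 * rpoch (1 / 4) i ^ 2) := by
    rw [sum_Icc_one_eq_sum_range (fun k : ℕ => rpoch 1 (k - 1) * rpoch (1 / 2) (k - 1) /
      ((4 * (k : ℚ) - 3) ^ 3 * (rpoch (1 / 4) (k - 1)) ^ 2))]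
    refine sum_congr rfl fun i _ => ?_
    rw [Nat.add_sub_cancel, rpoch_one]
    push_cast
    rw [show 4 * ((i : ℚ) + 1) - 3 = 4 * i + 1 by ring]
  refine ratCongr_of_eq_add (add_mem (add_mem ha hb) hc) ?_
  rw [h1, h4]
  linear_combination h2 + h3
end

section
/- Let p ≥ 5 be a prime. Then Σ_{k=1}^{(p-1)/2} 16^{k-1} / ((2k-1)^3 binom(2k-2, k-1)^2) ≡ (7/4) B_{p-3} (mod p), where B_{p-3} is the (p-3)-rd Bernoulli number. -/
open Finset

/-- The ratio `(k-1)(k-2)⋯(k-i) / ((k+1)(k+2)⋯(k+i))` in a field. -/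
def pochRatio (K : Type*) [Field K] (k i : ℕ) : K :=
  ∏ j ∈ range i, ((k : K) - 1 - j) / (k + 1 + j)

section Field

variable {K : Type*} [Field K]

theorem pochRatio_zero (k : ℕ) : pochRatio K k 0 = 1 := by simp [pochRatio]

theorem pochRatio_succ (k i : ℕ) :
    pochRatio K k (i + 1) = pochRatio K k i * (((k : K) - 1 - i) / (k + 1 + i)) :=
  prod_range_succ _ _

theorem pochRatio_eq_zero {k i : ℕ} (hk : 1 ≤ k) (hi : k ≤ i) : pochRatio K k i = 0 := by
  refine prod_eq_zero (mem_range.2 (show k - 1 < i by lia)) ?_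
  simp [Nat.cast_sub hk]

theorem pochRatio_succ_left {k i : ℕ} (h : ∀ j ≤ i, ((k : K) + 1 + j) ≠ 0) :
    pochRatio K (k + 1) i * ((k - i) * (k + 1 + i)) = pochRatio K k i * (k * (k + 1)) := by
  induction i with
  | zero => simp [pochRatio_zero]
  | succ i ih =>
    have h1 := h i (by lia)
    have h2 := h (i + 1) le_rfl
    have ih := ih fun j hj => h j (by lia)
    rw [pochRatio_succ, pochRatio_succ]
    push_cast at h2 ⊢
    have h3 : (k : K) + 1 + 1 + i ≠ 0 := by convert h2 using 1; ring
    field_simp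
    linear_combination (k + 1 + 1 + i) * (k - 1 - i) * ih

theorem sum_alternating_mul_pochRatio_succ {k : ℕ} (m : ℕ)
    (h : ∀ j < m, ((k : K) + 2 + j) ≠ 0) :
    k * ∑ i ∈ range m, (-1) ^ i * (2 * i + 1) * pochRatio K (k + 1) i =
      -((-1) ^ m * m * (k + 1 + m) * pochRatio K (k + 1) m) := by
  induction m with
  | zero => simp
  | succ m ih =>
    have h1 := h m (by lia)
    rw [sum_range_succ, mul_add, ih fun j hj => h j (by lia), pochRatio_succ]
    push_cast
    have h3 : (k : K) + 1 + 1 + m ≠ 0 := by convert h1 using 1; ring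
    field_simp
    ring

/-- `n` plays the role of `-1/2`: `2n+1` vanishes in `K`, but no smaller positive integer does. -/
structure IsNegHalf (K : Type*) [Field K] (n : ℕ) : Prop where
  eq_zero : (2 * n + 1 : K) = 0
  ne_zero : ∀ k : ℕ, 0 < k → k ≤ 2 * n → (k : K) ≠ 0

namespace IsNegHalf

variable {n : ℕ}

theorem two_ne_zero (hn : IsNegHalf K n) (h0 : 0 < n) : (2 : K) ≠ 0 := by
  simpa using hn.ne_zero 2 (by lia) (by lia)

theorem odd_ne_zero (hn : IsNegHalf K n) {i : ℕ} (hi : i < n) : (2 * i + 1 : K) ≠ 0 := by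
  simpa using hn.ne_zero (2 * i + 1) (by lia) (by lia)

theorem centralBinom_ne_zero (hn : IsNegHalf K n) {k : ℕ} (hk : k ≤ n) : (k.centralBinom : K) ≠ 0 := by
  induction k with
  | zero => simp
  | succ k ih =>
    have h := congrArg (Nat.cast (R := K)) (Nat.succ_mul_centralBinom_succ k)
    push_cast at h
    intro h0
    rw [h0, mul_zero] at h
    simp [hn.two_ne_zero (by lia), hn.odd_ne_zero (show k < n by lia), ih (by lia)] at h

theorem sum_pochRatio_div_odd (hn : IsNegHalf K n) {k : ℕ} (hk : 1 ≤ k) (hkn : k ≤ n) :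
    ∑ i ∈ range n, (-1) ^ i * pochRatio K k i / (2 * i + 1) =
      16 ^ k / (4 * k * (k.centralBinom : K) ^ 2) := by
  have h2 := hn.two_ne_zero (by lia)
  have h4 : (4 : K) ≠ 0 := by
    rw [show (4 : K) = 2 * 2 by norm_num]; exact mul_ne_zero h2 h2
  induction k, hk using Nat.le_induction with
  | base =>
    rw [sum_eq_single_of_mem 0 (by simp; lia)]
    · simp [pochRatio_zero, Nat.centralBinom]
      field_simp
      norm_num
    · intro i _ hi
      simp [pochRatio_eq_zero le_rfl (show 1 ≤ i by lia)]
  | succ k hk ih =>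
    have ih := ih (by lia)
    have hk0 := hn.ne_zero k (by lia) (by lia)
    have hk1 := hn.ne_zero (k + 1) (by lia) (by lia)
    have hodd := hn.odd_ne_zero (show k < n by lia)
    have hc := hn.centralBinom_ne_zero (show k ≤ n by lia)
    have hc1 := hn.centralBinom_ne_zero (show k + 1 ≤ n by lia)
    have hs := congrArg (Nat.cast (R := K)) (Nat.succ_mul_centralBinom_succ k)
    have hvanish : ∑ i ∈ range n, (-1) ^ i * (2 * i + 1) * pochRatio K (k + 1) i = 0 := by
      have := sum_alternating_mul_pochRatio_succ (K := K) (k := k) n fun j hj => by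
        have := hn.ne_zero (k + 2 + j) (by lia) (by lia)
        exact_mod_cast this
      rw [pochRatio_eq_zero (by lia) hkn] at this
      simpa [hk0] using this
    have hrec : (2 * k + 1) ^ 2 * ∑ i ∈ range n, (-1) ^ i * pochRatio K (k + 1) i / (2 * i + 1) =
        4 * k * (k + 1) * ∑ i ∈ range n, (-1) ^ i * pochRatio K k i / (2 * i + 1) := by
      rw [← sub_eq_zero, ← hvanish, mul_sum, mul_sum, ← sum_sub_distrib]
      refine sum_congr rfl fun i hi => ?_
      have hi := mem_range.1 hi
      have hio := hn.odd_ne_zero hi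
      have := pochRatio_succ_left (K := K) (k := k) (i := i) fun j hj => by
        have := hn.ne_zero (k + 1 + j) (by lia) (by lia)
        exact_mod_cast this
      field_simp
      linear_combination 4 * this
    rw [ih] at hrec
    push_cast at hs hk1 ⊢
    have : ((k + 1).centralBinom : K) = 2 * (2 * k + 1) * k.centralBinom / (k + 1) := by
      rw [eq_div_iff hk1, mul_comm, hs]
    rw [this]
    apply mul_left_cancel₀ (pow_ne_zero 2 hodd)
    rw [hrec]
    generalize (2 * k + 1 : K) = d at hodd
    field_simp
    ring

theorem pochRatio_telescope (hn : IsNegHalf K n) {i N : ℕ} (hi : i < n) (hN : N ≤ n) :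
    (i + 1) ^ 2 * ∑ k ∈ range N, pochRatio K (k + 1) i / ((k + 1) * (k + 2 + i)) =
      ∏ j ∈ range (i + 1), ((N : K) - j) / (N + 1 + j) := by
  induction N with
  | zero => simp [prod_range_succ']
  | succ N ih =>
    rw [sum_range_succ, mul_add, ih (by lia)]
    have h1 : (N + 1 : K) ≠ 0 := by exact_mod_cast hn.ne_zero (N + 1) (by lia) (by lia)
    have h2 : (N + 2 + i : K) ≠ 0 := by exact_mod_cast hn.ne_zero (N + 2 + i) (by lia) (by lia)
    have hs : ∏ j ∈ range (i + 1), (((N + 1 : ℕ) : K) - j) / ((N + 1 : ℕ) + 1 + j) =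
        (N + 1) / (N + 2 + i) * pochRatio K (N + 1) i := by
      rw [prod_div_distrib, prod_range_succ', prod_range_succ, pochRatio, prod_div_distrib]
      push_cast
      simp only [add_sub_add_right_eq_sub, sub_zero, add_sub_cancel_right]
      rw [mul_comm (∏ j ∈ range i, ((N : K) - j)), mul_comm (∏ j ∈ range i, ((N : K) + 1 + 1 + j)),
        mul_div_mul_comm]
      ring
    have hr : ∏ j ∈ range (i + 1), ((N : K) - j) / (N + 1 + j) =
        (N - i) / (N + 1) * pochRatio K (N + 1) i := by
      rw [prod_div_distrib, prod_range_succ, prod_range_succ', pochRatio, prod_div_distrib]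
      push_cast
      simp only [add_sub_cancel_right, add_zero]
      rw [mul_comm (∏ j ∈ range i, ((N : K) - j)),
        mul_comm (∏ j ∈ range i, ((N : K) + 1 + (j + 1))), mul_div_mul_comm]
      simp only [add_comm, add_left_comm]
    rw [hs, hr]
    field_simp
    ring

theorem sum_pochRatio_div_sq (hn : IsNegHalf K n) {i : ℕ} (hi : i < n)
    (h0 : ∑ k ∈ range n, 1 / ((k : K) + 1) ^ 2 = 0) :
    ∑ k ∈ range n, pochRatio K (k + 1) i / ((k : K) + 1) ^ 2 =
      (-1) ^ i * (2 * ∑ m ∈ range i, 1 / ((m : K) + 1) ^ 2) := by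
  induction i with
  | zero => simpa [pochRatio_zero] using h0
  | succ i ih =>
    have hi1 : (i + 1 : K) ≠ 0 := by exact_mod_cast hn.ne_zero (i + 1) (by lia) (by lia)
    have ht := hn.pochRatio_telescope (show i < n by lia) le_rfl
    have hp : ∏ j ∈ range (i + 1), ((n : K) - j) / (n + 1 + j) = (-1) ^ (i + 1) := by
      rw [prod_congr rfl (g := fun _ => (-1 : K)) fun j hj => ?_]
      · simp
      · have hj := mem_range.1 hj
        have : (n + 1 + j : K) ≠ 0 := by exact_mod_cast hn.ne_zero (n + 1 + j) (by lia) (by lia)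
        rw [div_eq_iff this]
        linear_combination hn.eq_zero
    rw [hp] at ht
    have hadd : ∑ k ∈ range n, pochRatio K (k + 1) (i + 1) / ((k : K) + 1) ^ 2 =
        2 * ∑ k ∈ range n, pochRatio K (k + 1) i / ((k + 1) * (k + 2 + i)) -
          ∑ k ∈ range n, pochRatio K (k + 1) i / ((k : K) + 1) ^ 2 := by
      rw [mul_sum, ← sum_sub_distrib]
      refine sum_congr rfl fun k hk => ?_
      have hk := mem_range.1 hk
      have h1 : (k + 1 : K) ≠ 0 := by exact_mod_cast hn.ne_zero (k + 1) (by lia) (by lia)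
      have h2 : (k + 2 + i : K) ≠ 0 := by exact_mod_cast hn.ne_zero (k + 2 + i) (by lia) (by lia)
      have h3 : (k + 1 + 1 + i : K) ≠ 0 := by convert h2 using 1; ring
      rw [pochRatio_succ]
      push_cast
      field_simp
      ring
    rw [hadd, ih (by lia), sum_range_succ]
    rw [mul_comm, ← eq_div_iff (pow_ne_zero 2 hi1)] at ht
    rw [ht]
    field_simp
    ring

theorem centralBinom_eq (hn : IsNegHalf K n) {j : ℕ} (hj : j ≤ n) :
    (j.centralBinom : K) = (-4) ^ j * (n.choose j : K) := by
  induction j with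
  | zero => simp
  | succ j ih =>
    have h1 : (j + 1 : K) ≠ 0 := by exact_mod_cast hn.ne_zero (j + 1) (by lia) (by lia)
    have h := congrArg (Nat.cast (R := K)) (Nat.succ_mul_centralBinom_succ j)
    have hc := congrArg (Nat.cast (R := K)) (Nat.choose_succ_right_eq n j)
    push_cast [Nat.cast_sub (show j ≤ n by lia)] at h hc
    rw [ih (by lia)] at h
    apply mul_left_cancel₀ h1
    rw [h]
    linear_combination (-(-4) ^ (j + 1)) * hc + 2 * (-4) ^ j * n.choose j * hn.eq_zero

theorem sum_inv_centralBinom (hn : IsNegHalf K n) (h0 : ∑ k ∈ range n, 1 / ((k : K) + 1) ^ 2 = 0) :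
    ∑ j ∈ range n, 16 ^ j / ((2 * (j : K) + 1) ^ 3 * (j.centralBinom : K) ^ 2) =
      -∑ i ∈ range n, (∑ m ∈ range i, 1 / ((m : K) + 1) ^ 2) / (2 * (i : K) + 1) := by
  have hmain : ∑ k ∈ range n, 16 ^ (k + 1) / ((k + 1 : K) ^ 3 * ((k + 1).centralBinom : K) ^ 2) =
      8 * ∑ i ∈ range n, (∑ m ∈ range i, 1 / ((m : K) + 1) ^ 2) / (2 * (i : K) + 1) := by
    calc
      _ = ∑ k ∈ range n, 4 * (∑ i ∈ range n, (-1) ^ i * pochRatio K (k + 1) i / (2 * i + 1)) /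
            ((k : K) + 1) ^ 2 := by
        refine sum_congr rfl fun k hk => ?_
        have hk := mem_range.1 hk
        have h1 : (k + 1 : K) ≠ 0 := by exact_mod_cast hn.ne_zero (k + 1) (by lia) (by lia)
        have h2 := hn.two_ne_zero (by lia)
        have h4 : (4 : K) ≠ 0 := by
          rw [show (4 : K) = 2 * 2 by norm_num]; exact mul_ne_zero h2 h2
        have hc := hn.centralBinom_ne_zero (show k + 1 ≤ n by lia)
        rw [hn.sum_pochRatio_div_odd (by lia) (by lia)]
        push_cast
        field_simp
      _ = ∑ i ∈ range n, 4 * (-1) ^ i / (2 * (i : K) + 1) *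
            ∑ k ∈ range n, pochRatio K (k + 1) i / ((k : K) + 1) ^ 2 := by
        simp_rw [mul_sum, sum_div]
        rw [sum_comm]
        refine sum_congr rfl fun i _ => sum_congr rfl fun k _ => ?_
        ring
      _ = _ := by
        rw [mul_sum]
        refine sum_congr rfl fun i hi => ?_
        rw [hn.sum_pochRatio_div_sq (mem_range.1 hi) h0]
        have : ((-1 : K) ^ i) * (-1) ^ i = 1 := by rw [← mul_pow]; simp
        linear_combination
          (8 * (∑ m ∈ range i, 1 / ((m : K) + 1) ^ 2) / (2 * (i : K) + 1)) * this
  rcases Nat.eq_zero_or_pos n with rfl | hpos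
  · simp
  have h2 := hn.two_ne_zero hpos
  have h8 : (8 : K) ≠ 0 := by
    rw [show (8 : K) = 2 ^ 3 by norm_num]; exact pow_ne_zero 3 h2
  apply mul_left_cancel₀ h8
  rw [mul_neg, ← hmain, ← sum_range_reflect, mul_sum, ← sum_neg_distrib]
  refine sum_congr rfl fun k hk => ?_
  have hk := mem_range.1 hk
  have hsub : n - 1 - k = n - (k + 1) := by lia
  have h1 : (k + 1 : K) ≠ 0 := by exact_mod_cast hn.ne_zero (k + 1) (by lia) (by lia)
  have hodd : 2 * ((n - (k + 1) : ℕ) : K) + 1 = -2 * (k + 1) := by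
    push_cast [Nat.cast_sub (show k + 1 ≤ n by lia)]
    linear_combination hn.eq_zero
  have hc := hn.centralBinom_ne_zero (show k + 1 ≤ n by lia)
  have h16 : (16 : K) ≠ 0 := by
    rw [show (16 : K) = 2 ^ 4 by norm_num]; exact pow_ne_zero 4 h2
  have hsq : ∀ m : ℕ, ((-4 : K) ^ m) ^ 2 = 16 ^ m := fun m => by
    rw [← pow_mul, mul_comm, pow_mul]; norm_num
  rw [hn.centralBinom_eq (by lia)] at hc
  rw [hsub, hodd, hn.centralBinom_eq (by lia), hn.centralBinom_eq (by lia),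
    Nat.choose_symm (by lia), mul_pow, mul_pow, mul_pow, hsq, hsq]
  have hch := right_ne_zero_of_mul hc
  field_simp
  ring

end IsNegHalf

end Field

theorem Polynomial.hasseDeriv_bernoulli (n k : ℕ) (hk : k ≤ n) :
    Polynomial.hasseDeriv k (Polynomial.bernoulli n) =
      (n.choose k : ℚ) • Polynomial.bernoulli (n - k) := by
  ext i
  rw [hasseDeriv_coeff, coeff_smul, coeff_bernoulli, coeff_bernoulli, smul_eq_mul]
  by_cases h : i + k ≤ n
  · rw [if_pos h, if_pos (by lia), Nat.sub_sub, add_comm k i]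
    have := congrArg (Nat.cast (R := ℚ)) (Nat.choose_mul (n := n) (Nat.le_add_left k i))
    rw [Nat.add_sub_cancel_right] at this
    push_cast at this
    linear_combination (_root_.bernoulli (n - (i + k))) * this
  · rw [if_neg h, if_neg (by lia)]; simp

theorem Polynomial.bernoulli_eval_add (n : ℕ) (x y : ℚ) :
    (Polynomial.bernoulli n).eval (x + y) =
      ∑ k ∈ range (n + 1), n.choose k * (Polynomial.bernoulli (n - k)).eval x * y ^ k := by
  have hdeg : (taylor x (Polynomial.bernoulli n)).natDegree < n + 1 := by
    rw [natDegree_taylor, Nat.lt_succ_iff, natDegree_le_iff_coeff_eq_zero]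
    intro N hN
    rw [coeff_bernoulli, if_neg (by lia)]
  rw [add_comm, ← taylor_eval, eval_eq_sum_range' hdeg]
  refine sum_congr rfl fun k hk => ?_
  rw [taylor_coeff, hasseDeriv_bernoulli n k (Nat.lt_succ_iff.1 (mem_range.1 hk)), eval_smul,
    smul_eq_mul]

theorem Polynomial.bernoulli_eval_half (k : ℕ) :
    (Polynomial.bernoulli k).eval (2⁻¹ : ℚ) = (2 / 2 ^ k - 1) * _root_.bernoulli k := by
  have h := bernoulliFun_eval_half k
  have h2 : bernoulliFun k 2⁻¹ = (((Polynomial.bernoulli k).eval (2⁻¹ : ℚ) : ℚ) : ℝ) := by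
    rw [bernoulliFun, eval_map, ← eq_ratCast (algebraMap ℚ ℝ), ← eval₂_at_apply]
    simp
  rw [h2] at h
  apply Rat.cast_injective (α := ℝ)
  rw [h]
  push_cast
  rfl

/-- Faulhaber's formula centred at half-integers, for even exponents. -/
theorem sum_range_pow_eq_sum_half {q : ℕ} (hq : Odd q) (h1 : 1 < q) (i : ℕ) :
    (q : ℚ) * ∑ l ∈ range i, ((l : ℚ) + 1) ^ (q - 1) =
      ∑ k ∈ range (q + 1), q.choose k * ((2 / 2 ^ (q - k) - 1) * bernoulli (q - k)) *
        ((2 * i + 1) / 2) ^ k := by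
  obtain ⟨r, rfl⟩ : ∃ r, q = r + 1 := ⟨q - 1, by lia⟩
  have h := Polynomial.sum_range_pow_eq_bernoulli_sub (i + 1) r
  rw [sum_range_succ', Nat.succ_eq_add_one, bernoulli_eq_zero_of_odd hq h1,
    show ((i + 1 : ℕ) : ℚ) = 2⁻¹ + (2 * i + 1) / 2 by push_cast; ring,
    Polynomial.bernoulli_eval_add] at h
  simp only [Polynomial.bernoulli_eval_half, Nat.cast_zero, zero_pow (show r ≠ 0 by lia)] at h
  push_cast at h ⊢
  simpa using h

/-- `x` is a `p`-integral rational whose residue modulo `p` is `z`. -/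
def ReducesTo (p : ℕ) (x : ℚ) (z : ZMod p) : Prop :=
  ∃ a b : ℤ, (b : ZMod p) ≠ 0 ∧ x * b = a ∧ z * b = a

namespace ReducesTo

variable {p : ℕ} {x y : ℚ} {z w : ZMod p}

theorem intCast [Fact p.Prime] (m : ℤ) : ReducesTo p m m := ⟨m, 1, by simp, by simp, by simp⟩

theorem natCast [Fact p.Prime] (m : ℕ) : ReducesTo p m m := by exact_mod_cast intCast (p := p) m

theorem one [Fact p.Prime] : ReducesTo p 1 1 := by simpa using natCast (p := p) 1

theorem ofNat [Fact p.Prime] (m : ℕ) [m.AtLeastTwo] :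
    ReducesTo p (OfNat.ofNat m) (OfNat.ofNat m) := by
  simpa using natCast (p := p) (OfNat.ofNat m)

theorem add [Fact p.Prime] (hx : ReducesTo p x z) (hy : ReducesTo p y w) :
    ReducesTo p (x + y) (z + w) := by
  obtain ⟨a, b, hb, h1, h2⟩ := hx
  obtain ⟨c, d, hd, h3, h4⟩ := hy
  refine ⟨a * d + c * b, b * d, by simp [hb, hd], ?_, ?_⟩
  · push_cast; linear_combination (d : ℚ) * h1 + b * h3
  · push_cast; linear_combination (d : ZMod p) * h2 + b * h4

theorem mul [Fact p.Prime] (hx : ReducesTo p x z) (hy : ReducesTo p y w) :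
    ReducesTo p (x * y) (z * w) := by
  obtain ⟨a, b, hb, h1, h2⟩ := hx
  obtain ⟨c, d, hd, h3, h4⟩ := hy
  refine ⟨a * c, b * d, by simp [hb, hd], ?_, ?_⟩
  · push_cast; rw [← h1, ← h3]; ring
  · push_cast; rw [← h2, ← h4]; ring

theorem neg [Fact p.Prime] (hx : ReducesTo p x z) : ReducesTo p (-x) (-z) := by
  simpa using (intCast (p := p) (-1)).mul hx

theorem sub [Fact p.Prime] (hx : ReducesTo p x z) (hy : ReducesTo p y w) :
    ReducesTo p (x - y) (z - w) := by
  simpa [sub_eq_add_neg] using hx.add hy.neg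

theorem inv [Fact p.Prime] (hx : ReducesTo p x z) (hz : z ≠ 0) : ReducesTo p x⁻¹ z⁻¹ := by
  obtain ⟨a, b, hb, h1, h2⟩ := hx
  have ha : (a : ZMod p) ≠ 0 := h2 ▸ mul_ne_zero hz hb
  have ha' : (a : ℚ) ≠ 0 := by rintro h; simp_all
  have hx : x ≠ 0 := by rintro rfl; simp at h1; exact ha' h1.symm
  refine ⟨b, a, ha, ?_, ?_⟩
  · rw [← h1]; field_simp
  · rw [← h2]; field_simp

theorem div [Fact p.Prime] (hx : ReducesTo p x z) (hy : ReducesTo p y w) (hw : w ≠ 0) :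
    ReducesTo p (x / y) (z / w) := by
  simpa [div_eq_mul_inv] using hx.mul (hy.inv hw)

theorem pow [Fact p.Prime] (hx : ReducesTo p x z) (m : ℕ) : ReducesTo p (x ^ m) (z ^ m) := by
  induction m with
  | zero => simpa using one
  | succ m ih => simpa [pow_succ] using ih.mul hx

theorem sum [Fact p.Prime] {ι : Type*} {s : Finset ι} {f : ι → ℚ} {g : ι → ZMod p}
    (h : ∀ i ∈ s, ReducesTo p (f i) (g i)) : ReducesTo p (∑ i ∈ s, f i) (∑ i ∈ s, g i) := by
  classical
  induction s using Finset.induction_on with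
  | empty => simpa using natCast (p := p) 0
  | insert a s ha ih =>
    rw [sum_insert ha, sum_insert ha]
    exact (h a (by simp)).add (ih fun i hi => h i (by simp [hi]))

theorem unique [Fact p.Prime] (h : ReducesTo p x z) (h' : ReducesTo p x w) : z = w := by
  obtain ⟨a, b, hb, h1, h2⟩ := h
  obtain ⟨c, d, hd, h3, h4⟩ := h'
  have h5 : (a * d : ℚ) = c * b := by rw [← h1, ← h3]; ring
  have h6 : (a * d : ZMod p) = c * b := by
    have h7 : a * d = c * b := by exact_mod_cast h5
    exact_mod_cast congrArg (Int.cast (R := ZMod p)) h7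
  apply mul_right_cancel₀ (mul_ne_zero hb hd)
  linear_combination (d : ZMod p) * h2 - b * h4 + h6

end ReducesTo

theorem ZMod.natCast_ne_zero_of_lt {p k : ℕ} (h0 : 0 < k) (hk : k < p) : (k : ZMod p) ≠ 0 := by
  rw [Ne, ZMod.natCast_eq_zero_iff]
  exact Nat.not_dvd_of_pos_of_lt h0 hk

theorem exists_reducesTo_bernoulli {p : ℕ} [Fact p.Prime] (j : ℕ) (hj : j + 1 < p) :
    ∃ z : ZMod p, ReducesTo p (bernoulli j) z := by
  induction j using Nat.strong_induction_on with
  | _ j ih =>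
    have hj1 : ((j + 1 : ℕ) : ZMod p) ≠ 0 := ZMod.natCast_ne_zero_of_lt (by lia) hj
    choose! β hβ using fun k (hk : k < j) => ih k hk (by lia)
    have h := sum_bernoulli (j + 1)
    rw [sum_range_succ, Nat.choose_succ_self_right] at h
    have h' : bernoulli j = ((if j + 1 = 1 then 1 else 0 : ℕ) -
        ∑ k ∈ range j, (j + 1).choose k * bernoulli k) / (j + 1 : ℕ) := by
      rw [eq_div_iff (by positivity)]
      push_cast at h ⊢
      linear_combination h
    rw [h']
    exact ⟨_, ((ReducesTo.natCast _).sub (ReducesTo.sum fun k hk =>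
      (ReducesTo.natCast _).mul (hβ k (mem_range.1 hk)))).div (ReducesTo.natCast _) hj1⟩

theorem ZMod.sum_range_natCast {p : ℕ} [Fact p.Prime] {M : Type*} [AddCommMonoid M]
    (f : ZMod p → M) : ∑ k ∈ range p, f k = ∑ x : ZMod p, f x :=
  sum_bij' (fun k _ => (k : ZMod p)) (fun x _ => x.val) (by simp)
    (fun x _ => mem_range.2 x.val_lt) (fun k hk => ZMod.val_cast_of_lt (mem_range.1 hk))
    (fun x _ => ZMod.natCast_zmod_val x) (by simp)

theorem sum_range_two_mul_add_one {M : Type*} [AddCommMonoid M] (f : ℕ → M) (n : ℕ) :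
    ∑ k ∈ range (2 * n + 1), f k =
      f 0 + ∑ i ∈ range n, f (2 * i + 1) + ∑ i ∈ range n, f (2 * i + 2) := by
  induction n with
  | zero => simp
  | succ n ih =>
    rw [show 2 * (n + 1) + 1 = 2 * n + 1 + 1 + 1 by ring, sum_range_succ, sum_range_succ, ih,
      sum_range_succ, sum_range_succ]
    abel

section ZMod

variable {p n : ℕ} [Fact p.Prime]

theorem isNegHalf_zmod (hn : p = 2 * n + 1) : IsNegHalf (ZMod p) n where
  eq_zero := by
    have h : ((2 * n + 1 : ℕ) : ZMod p) = 0 := by rw [← hn, ZMod.natCast_self]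
    exact_mod_cast h
  ne_zero _ h0 hk := ZMod.natCast_ne_zero_of_lt h0 (by lia)

theorem sum_even_pow_eq_sum_odd_pow (hn : p = 2 * n + 1) {e : ℕ} (he : Even e) :
    ∑ i ∈ range n, (2 * (i : ZMod p) + 2) ^ e = ∑ i ∈ range n, (2 * (i : ZMod p) + 1) ^ e := by
  rw [← sum_range_reflect]
  refine sum_congr rfl fun i hi => ?_
  have hi := mem_range.1 hi
  rw [← he.neg_pow, Nat.sub_sub, Nat.cast_sub (by lia)]
  congr 1
  push_cast
  linear_combination -(isNegHalf_zmod hn).eq_zero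

theorem sum_odd_pow_eq_zero (hn : p = 2 * n + 1) {e : ℕ} (he : Even e) (h0 : 0 < e)
    (hep : e < p - 1) : ∑ i ∈ range n, (2 * (i : ZMod p) + 1) ^ e = 0 := by
  rcases Nat.eq_zero_or_pos n with rfl | hpos
  · simp
  have h := FiniteField.sum_pow_lt_card_sub_one (ZMod p) e (by rwa [ZMod.card])
  rw [← ZMod.sum_range_natCast, show range p = range (2 * n + 1) by rw [hn],
    sum_range_two_mul_add_one] at h
  push_cast at h
  rw [zero_pow h0.ne', zero_add, sum_even_pow_eq_sum_odd_pow hn he, ← two_mul] at h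
  exact (mul_eq_zero.1 h).resolve_left ((isNegHalf_zmod hn).two_ne_zero hpos)

theorem one_div_sq_eq_pow (hp : 5 ≤ p) {x : ZMod p} (hx : x ≠ 0) : 1 / x ^ 2 = x ^ (p - 3) := by
  rw [div_eq_iff (pow_ne_zero 2 hx), ← pow_add, show p - 3 + 2 = p - 1 by lia,
    ZMod.pow_card_sub_one_eq_one hx]

theorem sum_one_div_sq_eq_zero (hn : p = 2 * n + 1) (hp : 5 ≤ p) :
    ∑ k ∈ range n, 1 / ((k : ZMod p) + 1) ^ 2 = 0 := by
  have h2 := (isNegHalf_zmod hn).two_ne_zero (by lia)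
  have he : Even (p - 3) := ⟨n - 1, by lia⟩
  have h := sum_even_pow_eq_sum_odd_pow hn he
  rw [sum_odd_pow_eq_zero hn he (by lia) (by lia)] at h
  apply mul_left_cancel₀ (pow_ne_zero (p - 3) h2)
  rw [mul_zero, ← h, mul_sum]
  refine sum_congr rfl fun k hk => ?_
  have hk := mem_range.1 hk
  rw [one_div_sq_eq_pow hp, ← mul_pow, mul_add, mul_one]
  exact_mod_cast ZMod.natCast_ne_zero_of_lt (show 0 < k + 1 by lia) (by lia)

theorem sum_harmonic_sq_div_odd (hn : p = 2 * n + 1) (hp : 5 ≤ p) {β : ZMod p}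
    (hβ : ReducesTo p (bernoulli (p - 3)) β) :
    ∑ i ∈ range n, (∑ m ∈ range i, 1 / ((m : ZMod p) + 1) ^ 2) / (2 * (i : ZMod p) + 1) =
      -(7 / 4 * β) := by
  have hH := isNegHalf_zmod hn
  have h2 := hH.two_ne_zero (by lia)
  obtain ⟨q, hq⟩ : ∃ q, p = q + 2 := ⟨p - 2, by lia⟩
  have hqodd : Odd q := ⟨n - 1, by lia⟩
  have hq0 : (q : ZMod p) ≠ 0 := ZMod.natCast_ne_zero_of_lt (by lia) (by lia)
  choose! b hb using fun j (hj : j + 1 < p) => exists_reducesTo_bernoulli (p := p) j hj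
  have hη : ∀ j, j + 1 < p → ReducesTo p ((2 / 2 ^ j - 1) * bernoulli j)
      ((2 / 2 ^ j - 1) * b j) := fun j hj =>
    (((ReducesTo.ofNat 2).div ((ReducesTo.ofNat 2).pow j) (pow_ne_zero j h2)).sub
      ReducesTo.one).mul (hb j hj)
  set η : ℕ → ZMod p := fun j => (2 / 2 ^ j - 1) * b j
  have hηodd : ∀ j, j + 1 < p → Odd j → η j = 0 := fun j hj hodd => by
    refine (hη j hj).unique ?_
    have : (2 / 2 ^ j - 1) * bernoulli j = 0 := by
      rcases eq_or_ne j 1 with rfl | h1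
      · norm_num
      · rw [bernoulli_eq_zero_of_odd hodd (by obtain ⟨r, rfl⟩ := hodd; lia), mul_zero]
    rw [this]
    simpa using ReducesTo.natCast (p := p) 0
  have hη3 : η (q - 1) = 7 * β := by
    have hbβ : b (q - 1) = β := (hb (q - 1) (by lia)).unique (by convert hβ using 2; lia)
    have hpow : (2 : ZMod p) ^ (q - 1) * 4 = 1 := by
      rw [show (4 : ZMod p) = 2 ^ 2 by norm_num, ← pow_add, show q - 1 + 2 = p - 1 by lia,
        ZMod.pow_card_sub_one_eq_one h2]
    have : (2 : ZMod p) / 2 ^ (q - 1) = 8 := by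
      rw [div_eq_iff (pow_ne_zero _ h2)]
      linear_combination -2 * hpow
    simp only [η, hbβ, this]
    norm_num
  have hF : ∀ i, (q : ZMod p) * ∑ l ∈ range i, ((l : ZMod p) + 1) ^ (q - 1) =
      ∑ k ∈ range (q + 1), q.choose k * η (q - k) * ((2 * i + 1) / 2) ^ k := fun i => by
    refine ReducesTo.unique (x := (q : ℚ) * ∑ l ∈ range i, ((l : ℚ) + 1) ^ (q - 1)) ?_ ?_
    · exact (ReducesTo.natCast q).mul (ReducesTo.sum fun l _ =>
        ((ReducesTo.natCast l).add ReducesTo.one).pow _)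
    · rw [sum_range_pow_eq_sum_half hqodd (by lia)]
      exact ReducesTo.sum fun k _ => ((ReducesTo.natCast _).mul (hη _ (by lia))).mul
        (((((ReducesTo.ofNat 2).mul (ReducesTo.natCast i)).add ReducesTo.one).div
          (ReducesTo.ofNat 2) h2).pow k)
  have hterm : ∀ k ∈ range (q + 1), ∑ i ∈ range n, q.choose k * η (q - k) *
      ((2 * (i : ZMod p) + 1) / 2) ^ k / (2 * i + 1) = if k = 1 then q * (7 * β) * (n / 2) else 0 := by
    intro k hk
    have hk := mem_range.1 hk
    rcases Nat.even_or_odd k with hek | hok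
    · have : k ≠ 1 := by rintro rfl; simp at hek
      rw [hηodd (q - k) (by lia) (Nat.Odd.sub_even (by lia) hqodd hek)]
      simp [this]
    obtain ⟨m, rfl⟩ := hok
    have hcancel : ∀ i ∈ range n, q.choose (2 * m + 1) * η (q - (2 * m + 1)) *
        ((2 * (i : ZMod p) + 1) / 2) ^ (2 * m + 1) / (2 * i + 1) =
        q.choose (2 * m + 1) * η (q - (2 * m + 1)) / 2 ^ (2 * m + 1) *
          (2 * (i : ZMod p) + 1) ^ (2 * m) := fun i hi => by
      have := hH.odd_ne_zero (mem_range.1 hi)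
      rw [div_pow, pow_succ (2 * (i : ZMod p) + 1)]
      field_simp
    rw [sum_congr rfl hcancel, ← mul_sum]
    rcases Nat.eq_zero_or_pos m with rfl | hm
    · simp [hη3]
      ring
    · rw [sum_odd_pow_eq_zero hn (even_two_mul m) (by lia) (by lia), if_neg (by lia), mul_zero]
  apply mul_left_cancel₀ hq0
  calc
    _ = ∑ i ∈ range n, ∑ k ∈ range (q + 1), q.choose k * η (q - k) *
          ((2 * (i : ZMod p) + 1) / 2) ^ k / (2 * i + 1) := by
      rw [mul_sum]
      refine sum_congr rfl fun i hi => ?_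
      rw [← sum_div, ← hF i, mul_div_assoc]
      congr 2
      refine sum_congr rfl fun l hl => ?_
      have hl := mem_range.1 hl
      have hi := mem_range.1 hi
      rw [one_div_sq_eq_pow hp, show p - 3 = q - 1 by lia]
      exact_mod_cast ZMod.natCast_ne_zero_of_lt (show 0 < l + 1 by lia) (by lia)
    _ = q * (7 * β) * (n / 2) := by
      rw [sum_comm, sum_congr rfl hterm, sum_ite_eq', if_pos (by simp; lia)]
    _ = _ := by
      have h4 : (4 : ZMod p) = 2 * 2 := by norm_num
      rw [h4]
      field_simp
      linear_combination β * 7 * hH.eq_zero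

theorem ReducesTo.ratCongr {x y : ℚ} {z : ZMod p} (hx : ReducesTo p x z) (hy : ReducesTo p y z) :
    ratCongr x y p 1 := by
  obtain ⟨a, b, hb, h1, h2⟩ := hx.sub hy
  rw [sub_self, zero_mul, eq_comm, ZMod.intCast_zmod_eq_zero_iff_dvd] at h2
  obtain ⟨c, rfl⟩ := h2
  refine ⟨c, b, fun h => hb ((ZMod.intCast_zmod_eq_zero_iff_dvd b p).2 h), ?_⟩
  rw [h1]
  push_cast
  ring

end ZMod

/-- Z.-W. Sun: for primes `p ≥ 5`,
`Σ_{k=1}^{(p-1)/2} 16^{k-1}/((2k-1)^3 C(2k-2,k-1)^2) ≡ (7/4) B_{p-3} (mod p)`. -/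
theorem stmt15 (p : ℕ) (hp : p.Prime) (hp5 : 5 ≤ p) :
    ratCongr
      (∑ k ∈ Finset.Icc 1 ((p - 1) / 2),
        (16 : ℚ) ^ (k - 1) /
          ((2 * (k : ℚ) - 1) ^ 3 * ((Nat.choose (2 * k - 2) (k - 1) : ℚ)) ^ 2))
      (7 / 4 * bernoulli (p - 3)) p 1 := by
  have := Fact.mk hp
  obtain ⟨n, hn⟩ : ∃ n, p = 2 * n + 1 := by
    obtain ⟨n, hn⟩ := hp.odd_of_ne_two (by lia)
    exact ⟨n, hn⟩
  have hH := isNegHalf_zmod hn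
  obtain ⟨β, hβ⟩ := exists_reducesTo_bernoulli (p := p) (p - 3) (by lia)
  have h4 : (4 : ZMod p) ≠ 0 := by
    simpa using ZMod.natCast_ne_zero_of_lt (p := p) (show 0 < 4 by lia) (by lia)
  refine ReducesTo.ratCongr ?_ (((ReducesTo.ofNat 7).div (ReducesTo.ofNat 4) h4).mul hβ)
  have hsum := hH.sum_inv_centralBinom (sum_one_div_sq_eq_zero hn hp5)
  rw [sum_harmonic_sq_div_odd hn hp5 hβ, neg_neg] at hsum
  rw [← hsum, show (p - 1) / 2 = n by lia, ← Finset.Ico_add_one_right_eq_Icc,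
    sum_Ico_eq_sum_range, Nat.add_sub_cancel]
  refine ReducesTo.sum fun j hj => ?_
  have hj := mem_range.1 hj
  have hden : 2 * ((1 + j : ℕ) : ℚ) - 1 = 2 * j + 1 := by push_cast; ring
  rw [hden, Nat.add_sub_cancel_left, show 2 * (1 + j) - 2 = 2 * j by lia]
  exact ((ReducesTo.ofNat 16).pow j).div
    (((((ReducesTo.ofNat 2).mul (ReducesTo.natCast j)).add ReducesTo.one).pow 3).mul
      ((ReducesTo.natCast _).pow 2))
    (mul_ne_zero (pow_ne_zero 3 (hH.odd_ne_zero hj))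
      (pow_ne_zero 2 (hH.centralBinom_ne_zero hj.le)))
end
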